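/- Corollary 1. If r > 2 or p > 2 (i.e., either all CN types have minimum distance greater than 2 or all VN types have minimum distance greater than 2), then T > 0 and the growth rate of the weight distribution satisfies G(alpha) = (T/psi) alpha log alpha + O(alpha); consequently alpha* > 0, i.e., the ensemble sequence has good growth rate behavior. -/

import Mathlib

open Filter Polynomial Finset
open scoped Classical

/-- An irregular doubly-generalized LDPC (D-GLDPC) code ensemble, specified by:
check-node (CN) types `Fin nc` with lengths `s`, dimensions `hdim`, minimum distances `rd`,
weight enumerator coefficients `A`; variable-node (VN) types `Fin nv` with dimensions `kdim`,
lengths `q`, minimum distances `pd`, input-output weight enumerator coefficients `B`;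
and edge fractions `ρ` (CN side) and `lam` (VN side). -/
structure DGLDPC where
  nc : ℕ
  nv : ℕ
  hnc : 0 < nc
  hnv : 0 < nv
  s : Fin nc → ℕ
  hdim : Fin nc → ℕ
  rd : Fin nc → ℕ
  A : Fin nc → ℕ → ℕ
  kdim : Fin nv → ℕ
  q : Fin nv → ℕ
  pd : Fin nv → ℕ
  B : Fin nv → ℕ → ℕ → ℕ
  ρ : Fin nc → ℝ
  lam : Fin nv → ℝ
  h_hdim : ∀ t, 1 ≤ hdim t
  h_hs : ∀ t, hdim t < s t
  h_rd2 : ∀ t, 2 ≤ rd t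
  h_rds : ∀ t, rd t ≤ s t
  hA0 : ∀ t, A t 0 = 1
  hAsupp : ∀ t u, u ≠ 0 → (u < rd t ∨ s t < u) → A t u = 0
  hAr : ∀ t, 0 < A t (rd t)
  h_k1 : ∀ t, 1 ≤ kdim t
  h_q1 : ∀ t, 1 ≤ q t
  h_pd2 : ∀ t, 2 ≤ pd t
  h_pdq : ∀ t, pd t ≤ q t
  hB00 : ∀ t, B t 0 0 = 1
  hBsupp : ∀ t u v, ¬(u = 0 ∧ v = 0) →
    ¬(1 ≤ u ∧ u ≤ kdim t ∧ pd t ≤ v ∧ v ≤ q t) → B t u v = 0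
  hBp : ∀ t, ∃ u, 0 < B t u (pd t)
  hρpos : ∀ t, 0 < ρ t
  hlampos : ∀ t, 0 < lam t
  hρsum : ∑ t, ρ t = 1
  hlamsum : ∑ t, lam t = 1

namespace DGLDPC

variable (M : DGLDPC)

/-- `∫ρ = ∑_t ρ_t / s_t`. -/
noncomputable def intrho : ℝ := ∑ t, M.ρ t / (M.s t : ℝ)

/-- `∫λ = ∑_t λ_t / q_t`. -/
noncomputable def intlam : ℝ := ∑ t, M.lam t / (M.q t : ℝ)

/-- Fraction `δ_t = λ_t / (q_t ∫λ)` of VNs of type `t`. -/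
noncomputable def δfrac (t : Fin M.nv) : ℝ := M.lam t / ((M.q t : ℝ) * M.intlam)

/-- `r`: the smallest CN minimum distance. -/
noncomputable def r : ℕ := sInf (Set.range M.rd)

/-- `p`: the smallest VN minimum distance. -/
noncomputable def p : ℕ := sInf (Set.range M.pd)

/-- `ψ = r/(r-1)`. -/
noncomputable def ψ : ℝ := (M.r : ℝ) / ((M.r : ℝ) - 1)

/-- `C = r ∑_{t ∈ X_c} ρ_t A_r^{(t)} / s_t`, sum over CN types of minimum distance `r`. -/
noncomputable def Cparam : ℝ :=
  (M.r : ℝ) * ∑ t ∈ Finset.univ.filter (fun t => M.rd t = M.r),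
    M.ρ t * (M.A t M.r : ℝ) / (M.s t : ℝ)

/-- `T_{i,j} = (j - ψ)/i`. -/
noncomputable def Tij (i j : ℕ) : ℝ := ((j : ℝ) - M.ψ) / (i : ℝ)

/-- `S⁻`: pairs `(i,j) ≠ (0,0)` with `B_{i,j}^{(t)} > 0` for some VN type `t`. -/
def Sminus : Set (ℕ × ℕ) := {ij | (∃ t, 0 < M.B t ij.1 ij.2) ∧ ij ≠ (0, 0)}

/-- `T = min_{(i,j) ∈ S⁻} T_{i,j}`. -/
noncomputable def T : ℝ := sInf {x : ℝ | ∃ ij ∈ M.Sminus, x = M.Tij ij.1 ij.2}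

/-- The set of candidate exponents whose infimum is
`ξ = min { r̄/r, χ/ψ + 1, 2 }` (terms coming from empty families being dropped):
it contains `2`, the values `i/r` for `i > r` with `A_i^{(t)} > 0` for some `t`
(whose minimum is `r̄/r`), and the values `(T_{i,j} - T) i / ψ + 1` for `(i,j) ∈ S⁻`
with `T_{i,j} > T` (whose minimum is `χ/ψ + 1`). -/
noncomputable def xiSet : Set ℝ :=
  {2} ∪ {x : ℝ | ∃ i : ℕ, M.r < i ∧ (∃ t, 0 < M.A t i) ∧ x = (i : ℝ) / (M.r : ℝ)}
    ∪ {x : ℝ | ∃ ij ∈ M.Sminus, M.T < M.Tij ij.1 ij.2 ∧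
        x = (M.Tij ij.1 ij.2 - M.T) * (ij.1 : ℝ) / M.ψ + 1}

/-- The exponent `ξ = min { r̄/r, χ/ψ + 1, 2 }`. -/
noncomputable def ξexp : ℝ := sInf M.xiSet

/-- The polynomial `Q₁(x)`; the sum effectively ranges over `t ∈ Y_v` and `(i,j) ∈ P_t`,
i.e. over all `(t,i,j)` with `(i,j) ∈ S_t⁻` and `T_{i,j} = T`. -/
noncomputable def Q1 (x : ℝ) : ℝ :=
  ∑ t, (M.lam t / (M.q t : ℝ)) *
    ∑ i ∈ Finset.range (M.kdim t + 1), ∑ j ∈ Finset.range (M.q t + 1),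
      if 0 < M.B t i j ∧ (i, j) ≠ (0, 0) ∧ M.Tij i j = M.T then
        (j : ℝ) * (M.B t i j : ℝ) * M.Cparam ^ ((j : ℝ) / (M.r : ℝ)) *
          (M.intlam / Real.exp 1) ^ ((i : ℝ) * M.T / M.ψ) * x ^ i
      else 0

/-- The polynomial `Q₂(x)`. -/
noncomputable def Q2 (x : ℝ) : ℝ :=
  ∑ t, (M.lam t / (M.q t : ℝ)) *
    ∑ i ∈ Finset.range (M.kdim t + 1), ∑ j ∈ Finset.range (M.q t + 1),
      if 0 < M.B t i j ∧ (i, j) ≠ (0, 0) ∧ M.Tij i j = M.T then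
        (i : ℝ) * (M.B t i j : ℝ) * M.Cparam ^ ((j : ℝ) / (M.r : ℝ)) *
          (M.intlam / Real.exp 1) ^ ((i : ℝ) * M.T / M.ψ) * x ^ i
      else 0

/-- Number of Tanner graph edges, `E = n/∫λ` (exact on admissible `n`). -/
noncomputable def En (n : ℕ) : ℕ := ⌊(n : ℝ) / M.intlam⌋₊

/-- Number of CNs of type `t`, `γ_t m = E ρ_t / s_t` (exact on admissible `n`). -/
noncomputable def cExp (n : ℕ) (t : Fin M.nc) : ℕ := ⌊(M.En n : ℝ) * M.ρ t / (M.s t : ℝ)⌋₊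

/-- Number of VNs of type `t`, `δ_t n = E λ_t / q_t` (exact on admissible `n`). -/
noncomputable def vExp (n : ℕ) (t : Fin M.nv) : ℕ := ⌊(M.En n : ℝ) * M.lam t / (M.q t : ℝ)⌋₊

/-- The CN weight enumerating polynomial `A^{(t)}(x)`. -/
noncomputable def Apoly (t : Fin M.nc) : Polynomial ℝ :=
  ∑ u ∈ Finset.range (M.s t + 1), Polynomial.C ((M.A t u : ℕ) : ℝ) * Polynomial.X ^ u

/-- The VN bivariate weight enumerating polynomial `B^{(t)}(x,y)`, with the outer
variable recording input weight and the inner variable recording output weight. -/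
noncomputable def Bpoly (t : Fin M.nv) : Polynomial (Polynomial ℝ) :=
  ∑ u ∈ Finset.range (M.kdim t + 1),
    Polynomial.C (∑ v ∈ Finset.range (M.q t + 1),
      Polynomial.C ((M.B t u v : ℕ) : ℝ) * Polynomial.X ^ v) * Polynomial.X ^ u

/-- `N_c(v)`: the number of check-valid assignments of weight `v`, i.e. the coefficient
of `x^v` in `∏_t (A^{(t)}(x))^{γ_t m}`. -/
noncomputable def NcCount (n v : ℕ) : ℝ := (∏ t, M.Apoly t ^ M.cExp n t).coeff v

/-- `N_v(u,v)`: the coefficient of `x^u y^v` in `∏_t (B^{(t)}(x,y))^{δ_t n}`. -/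
noncomputable def NvCount (n u v : ℕ) : ℝ := ((∏ t, M.Bpoly t ^ M.vExp n t).coeff u).coeff v

/-- The expected number of codewords of weight `w`:
`E[N_w] = ∑_v N_v(w,v) N_c(v) / binom(E,v)`. -/
noncomputable def ENw (n w : ℕ) : ℝ :=
  ∑ v ∈ Finset.range (M.En n + 1),
    M.NvCount n w v * M.NcCount n v / ((M.En n).choose v : ℝ)

/-- `n` is admissible for `α` when all the relevant quantities (`E`, the numbers of
CNs and VNs of each type, and the codeword weight `α n`) are integers and the
expected number of weight-`α n` codewords is positive. -/
def Adm (α : ℝ) (n : ℕ) : Prop :=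
  0 < n ∧ ((M.En n : ℝ) = (n : ℝ) / M.intlam) ∧
  (∀ t, (M.cExp n t : ℝ) = (M.En n : ℝ) * M.ρ t / (M.s t : ℝ)) ∧
  (∀ t, (M.vExp n t : ℝ) = (M.En n : ℝ) * M.lam t / (M.q t : ℝ)) ∧
  ((⌊α * (n : ℝ)⌋₊ : ℝ) = α * (n : ℝ)) ∧
  0 < M.ENw n ⌊α * (n : ℝ)⌋₊

/-- The sequence `(1/n) log E[N_{αn}]` whose limit (along admissible `n`) is `G(α)`. -/
noncomputable def grSeq (α : ℝ) (n : ℕ) : ℝ :=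
  (1 / (n : ℝ)) * Real.log (M.ENw n ⌊α * (n : ℝ)⌋₊)

end DGLDPC

namespace DGaux

/-- bivariate coefficient -/
noncomputable def cf (P : Polynomial (Polynomial ℝ)) (i j : ℕ) : ℝ := (P.coeff i).coeff j

def NN (P : Polynomial (Polynomial ℝ)) : Prop := ∀ i j, 0 ≤ cf P i j

lemma cf_mul (P Q : Polynomial (Polynomial ℝ)) (i j : ℕ) :
    cf (P * Q) i j = ∑ a ∈ Finset.HasAntidiagonal.antidiagonal i, ∑ b ∈ Finset.HasAntidiagonal.antidiagonal j,
      cf P a.1 b.1 * cf Q a.2 b.2 := by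
  simp [cf, Polynomial.coeff_mul]

lemma cf_add (P Q : Polynomial (Polynomial ℝ)) (i j : ℕ) :
    cf (P + Q) i j = cf P i j + cf Q i j := by simp [cf]

lemma cf_one (i j : ℕ) : cf 1 i j = if i = 0 ∧ j = 0 then 1 else 0 := by
  unfold cf
  rw [Polynomial.coeff_one]
  by_cases hi : i = 0
  · simp [hi, Polynomial.coeff_one]
  · simp [hi]

lemma NN.one : NN 1 := by
  intro i j; rw [cf_one]; split_ifs <;> norm_num

lemma NN.mul {P Q : Polynomial (Polynomial ℝ)} (hP : NN P) (hQ : NN Q) : NN (P * Q) := by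
  intro i j; rw [cf_mul]
  exact Finset.sum_nonneg fun a _ => Finset.sum_nonneg fun b _ => mul_nonneg (hP _ _) (hQ _ _)

lemma NN.pow {P : Polynomial (Polynomial ℝ)} (hP : NN P) (n : ℕ) : NN (P ^ n) := by
  induction n with
  | zero => simpa using NN.one
  | succ n ih => rw [pow_succ]; exact ih.mul hP

lemma NN.prod {ι : Type*} (s : Finset ι) {P : ι → Polynomial (Polynomial ℝ)}
    (hP : ∀ t, NN (P t)) : NN (∏ t ∈ s, P t) := by
  induction s using Finset.induction_on with
  | empty => simpa using NN.one
  | insert a s ha ih => rw [Finset.prod_insert ha]; exact (hP a).mul ih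

lemma cf_mul_ge {P Q : Polynomial (Polynomial ℝ)} (hP : NN P) (hQ : NN Q) (a b c d : ℕ) :
    cf P a b * cf Q c d ≤ cf (P * Q) (a + c) (b + d) := by
  rw [cf_mul]
  refine le_trans ?_ (Finset.single_le_sum (f := fun x : ℕ × ℕ =>
    ∑ y ∈ Finset.HasAntidiagonal.antidiagonal (b + d), cf P x.1 y.1 * cf Q x.2 y.2) ?_ (a := (a, c)) ?_)
  · refine le_trans ?_ (Finset.single_le_sum (f := fun y : ℕ × ℕ =>
      cf P a y.1 * cf Q c y.2) ?_ (a := (b, d)) ?_)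
    · exact le_rfl
    · intro y _; exact mul_nonneg (hP _ _) (hQ _ _)
    · simp
  · intro y _; exact Finset.sum_nonneg fun b _ => mul_nonneg (hP _ _) (hQ _ _)
  · simp

lemma cf_pow_ge {P : Polynomial (Polynomial ℝ)} (hP : NN P) (a b k : ℕ) :
    cf P a b ^ k ≤ cf (P ^ k) (k * a) (k * b) := by
  induction k with
  | zero => simp [cf_one]
  | succ k ih =>
    rw [pow_succ, pow_succ, Nat.succ_mul, Nat.succ_mul]
    exact le_trans (mul_le_mul_of_nonneg_right ih (hP _ _)) (cf_mul_ge (hP.pow k) hP _ _ _ _)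

lemma cf_choose {R : Polynomial (Polynomial ℝ)} (hR : NN R) (i j : ℕ) (h1 : 1 ≤ cf R i j)
    (N m : ℕ) : (N.choose m : ℝ) ≤ cf ((1 + R) ^ N) (m * i) (m * j) := by
  have hP : NN (1 + R) := fun a b => by
    rw [cf_add]; exact add_nonneg (NN.one _ _) (hR _ _)
  induction N generalizing m with
  | zero =>
    rcases m with _ | m
    · simp [cf_one]
    · have := NN.one ((m+1) * i) ((m+1)*j)
      simpa using this
  | succ N ih =>
    rw [pow_succ, mul_add, mul_one, cf_add]
    rcases m with _ | m
    · have h2 := ih 0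
      have h3 := ((hP.pow N).mul hR) (0 * i) (0 * j)
      simp at h2 h3 ⊢
      linarith
    · have h2 := ih (m+1)
      have h3 := cf_mul_ge (hP.pow N) hR (m * i) (m * j) i j
      have h4 := ih m
      have h5 := (hP.pow N) (m * i) (m * j)
      rw [Nat.choose_succ_succ, Nat.cast_add]
      rw [← Nat.succ_mul, ← Nat.succ_mul] at h3
      simp only [Nat.succ_eq_add_one] at h3 ⊢
      nlinarith

/-- support predicate -/
def Sup (D : ℕ → ℕ → Prop) (P : Polynomial (Polynomial ℝ)) : Prop :=
  ∀ i j, cf P i j ≠ 0 → D i j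

lemma Sup.mul {D : ℕ → ℕ → Prop} (hD : ∀ a b c d, D a b → D c d → D (a + c) (b + d))
    {P Q : Polynomial (Polynomial ℝ)} (hP : Sup D P) (hQ : Sup D Q) : Sup D (P * Q) := by
  intro i j h
  rw [cf_mul] at h
  obtain ⟨a, ha, h⟩ := Finset.exists_ne_zero_of_sum_ne_zero h
  obtain ⟨b, hb, h⟩ := Finset.exists_ne_zero_of_sum_ne_zero h
  rw [Finset.HasAntidiagonal.mem_antidiagonal] at ha hb
  rw [← ha, ← hb]
  exact hD _ _ _ _ (hP _ _ (left_ne_zero_of_mul h)) (hQ _ _ (right_ne_zero_of_mul h))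

lemma Sup.one {D : ℕ → ℕ → Prop} (h0 : D 0 0) : Sup D 1 := by
  intro i j h
  rw [cf_one] at h
  by_cases h' : i = 0 ∧ j = 0
  · rw [h'.1, h'.2]; exact h0
  · simp [h'] at h

lemma Sup.pow {D : ℕ → ℕ → Prop} (h0 : D 0 0)
    (hD : ∀ a b c d, D a b → D c d → D (a + c) (b + d))
    {P : Polynomial (Polynomial ℝ)} (hP : Sup D P) (n : ℕ) : Sup D (P ^ n) := by
  induction n with
  | zero => simpa using Sup.one h0
  | succ n ih => rw [pow_succ]; exact ih.mul hD hP

lemma Sup.prod {D : ℕ → ℕ → Prop} (h0 : D 0 0)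
    (hD : ∀ a b c d, D a b → D c d → D (a + c) (b + d)) {ι : Type*} (s : Finset ι)
    {P : ι → Polynomial (Polynomial ℝ)} (hP : ∀ t, Sup D (P t)) : Sup D (∏ t ∈ s, P t) := by
  induction s using Finset.induction_on with
  | empty => simpa using Sup.one h0
  | insert a s ha ih => rw [Finset.prod_insert ha]; exact (hP a).mul hD ih

lemma cf_le_eval {P : Polynomial (Polynomial ℝ)} (hP : NN P) {x y : ℝ} (hx : 0 ≤ x) (hy : 0 ≤ y)
    (i j : ℕ) : cf P i j * (x ^ i * y ^ j) ≤ Polynomial.evalEval y x P := by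
  have key : ∀ p : Polynomial ℝ, (∀ j, 0 ≤ p.coeff j) → ∀ j, p.coeff j * y ^ j ≤ p.eval y := by
    intro p hp j
    by_cases hj : j ∈ p.support
    · rw [Polynomial.eval_eq_sum, Polynomial.sum]
      exact Finset.single_le_sum (f := fun k => p.coeff k * y ^ k)
        (fun k _ => mul_nonneg (hp k) (pow_nonneg hy k)) hj
    · rw [Polynomial.notMem_support_iff.mp hj, zero_mul, Polynomial.eval_eq_sum, Polynomial.sum]
      exact Finset.sum_nonneg (fun k _ => mul_nonneg (hp k) (pow_nonneg hy k))
  have hnn : ∀ k, 0 ≤ (P.coeff k).eval y := fun k => by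
    have := key (P.coeff k) (hP k) 0
    exact le_trans (mul_nonneg (hP k 0) (pow_nonneg hy 0)) this
  have h1 : Polynomial.evalEval y x P = ∑ k ∈ P.support, (P.coeff k).eval y * x ^ k := by
    rw [Polynomial.evalEval, Polynomial.eval_eq_sum (p := P), Polynomial.sum, Polynomial.eval_finsetSum]
    simp
  have h2 : cf P i j * (x ^ i * y ^ j) ≤ (P.coeff i).eval y * x ^ i := by
    have := mul_le_mul_of_nonneg_right (key (P.coeff i) (hP i) j) (pow_nonneg hx i)
    unfold cf; linarith
  refine h2.trans ?_
  rw [h1]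
  by_cases hi : i ∈ P.support
  · exact Finset.single_le_sum (f := fun k => (P.coeff k).eval y * x ^ k)
        (fun k _ => mul_nonneg (hnn k) (pow_nonneg hx k)) hi
  · rw [Polynomial.notMem_support_iff.mp hi, Polynomial.eval_zero, zero_mul]
    exact Finset.sum_nonneg (fun k _ => mul_nonneg (hnn k) (pow_nonneg hx k))

lemma evalEval_prod_pow {ι : Type*} (s : Finset ι) (P : ι → Polynomial (Polynomial ℝ))
    (e : ι → ℕ) (x y : ℝ) :
    Polynomial.evalEval y x (∏ t ∈ s, P t ^ e t) = ∏ t ∈ s, (Polynomial.evalEval y x (P t)) ^ e t := by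
  have := map_prod (Polynomial.evalEvalRingHom y x) (fun t => P t ^ e t) s
  simp only [map_pow, Polynomial.coe_evalEvalRingHom] at this
  exact this

/-- cheap lower bound for coefficient of a product by a single factor -/
lemma cf_prod_ge {ι : Type*} [Fintype ι] (P : ι → Polynomial (Polynomial ℝ))
    (hP : ∀ t, NN (P t)) (h0 : ∀ t, 1 ≤ cf (P t) 0 0) (e : ι → ℕ) (t : ι) (i j : ℕ) :
    cf (P t ^ e t) i j ≤ cf (∏ t, P t ^ e t) i j := by
  classical
  rw [← Finset.mul_prod_erase Finset.univ _ (Finset.mem_univ t)]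
  have hone : ∀ s : Finset ι, 1 ≤ cf (∏ t ∈ s, P t ^ e t) 0 0 := by
    intro s
    induction s using Finset.induction_on with
    | empty => simp [cf_one]
    | insert a s ha ih =>
      rw [Finset.prod_insert ha]
      have h1 := cf_mul_ge ((hP a).pow (e a)) (NN.prod s (fun t => (hP t).pow (e t))) 0 0 0 0
      have h2 := cf_pow_ge (hP a) 0 0 (e a)
      have h3 := one_le_pow₀ (h0 a) (n := e a)
      simp only [mul_zero, add_zero] at h1 h2
      nlinarith
  have h1 := cf_mul_ge ((hP t).pow (e t)) (NN.prod (Finset.univ.erase t)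
    (fun t => (hP t).pow (e t))) i j 0 0
  have h2 := hone (Finset.univ.erase t)
  have h3 := (hP t).pow (e t) i j
  simp only [add_zero] at h1
  nlinarith

lemma choose_ge (N m : ℕ) (hm : 0 < m) (h : m ≤ N) : ((N : ℝ) / m) ^ m ≤ (N.choose m : ℝ) := by
  induction m generalizing N with
  | zero => omega
  | succ m ih =>
    obtain ⟨N, rfl⟩ : ∃ k, N = k + 1 := ⟨N - 1, by omega⟩
    have hid : ((N : ℝ) + 1) * (N.choose m : ℝ) = ((N+1).choose (m+1) : ℝ) * ((m : ℝ) + 1) := by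
      exact_mod_cast Nat.add_one_mul_choose_eq N m
    have hm1 : (0:ℝ) < (m:ℝ) + 1 := by positivity
    have e1 : ((N+1).choose (m+1) : ℝ) = ((N : ℝ) + 1) / ((m:ℝ)+1) * (N.choose m : ℝ) := by
      field_simp; linarith
    rw [e1, pow_succ, mul_comm]
    push_cast
    apply mul_le_mul_of_nonneg_left _ (by positivity)
    rcases Nat.eq_zero_or_pos m with rfl | hm'
    · simp
    · refine le_trans ?_ (ih N hm' (by omega))
      have hmr : (0:ℝ) < m := by exact_mod_cast hm'
      have hle : (m:ℝ) ≤ N := by exact_mod_cast (by omega : m ≤ N)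
      apply pow_le_pow_left₀ (by positivity)
      rw [div_le_div_iff₀ hm1 hmr]
      nlinarith

lemma choose_le (N m : ℕ) (hm : 0 < m) :
    (N.choose m : ℝ) ≤ (Real.exp 1 * N / m) ^ m := by
  have h1 : (N.choose m : ℝ) ≤ (N:ℝ)^m / (m.factorial : ℝ) := Nat.choose_le_pow_div m N
  have h2 := Real.pow_div_factorial_le_exp (m : ℝ) (by positivity) m
  have hmr : (0:ℝ) < m := by exact_mod_cast hm
  refine h1.trans ?_
  have h3 : Real.exp (m:ℝ) = Real.exp 1 ^ m := by rw [← Real.exp_nat_mul, mul_one]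
  rw [h3] at h2
  have hf : (0:ℝ) < m.factorial := by exact_mod_cast m.factorial_pos
  rw [div_pow, mul_pow]
  rw [div_le_div_iff₀ hf (by positivity)]
  rw [div_le_iff₀ hf] at h2
  have : (0:ℝ) ≤ (N:ℝ)^m := by positivity
  nlinarith

lemma fact_le (v : ℕ) (hv : 0 < v) :
    (v.factorial : ℝ) * Real.exp 1 ^ v ≤ Real.exp 1 * (v:ℝ) ^ (v + 1) := by
  induction v with
  | zero => omega
  | succ v ih =>
    rcases Nat.eq_zero_or_pos v with rfl | hv'
    · simp
    · have ih := ih hv'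
      have hvr : (0:ℝ) < v := by exact_mod_cast hv'
      have key : Real.exp 1 * (v:ℝ)^(v+1) ≤ ((v:ℝ)+1)^(v+1) := by
        have h1 : Real.exp (1 / ((v:ℝ)+1)) ≤ 1 + 1 / v := by
          have h := Real.add_one_le_exp (-(1 / ((v:ℝ)+1)))
          have h2 : -(1 / ((v:ℝ)+1)) + 1 = v / (v+1) := by field_simp; ring
          rw [h2, Real.exp_neg] at h
          have h3 := (le_inv_comm₀ (by positivity) (by positivity)).mp h
          refine h3.trans (le_of_eq ?_)
          field_simp
        have h2 := pow_le_pow_left₀ (by positivity) h1 (v+1)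
        rw [← Real.exp_nat_mul] at h2
        have e1 : ((v+1 : ℕ):ℝ) * (1 / ((v:ℝ)+1)) = 1 := by push_cast; field_simp
        rw [e1] at h2
        have e2 : (1 + 1/(v:ℝ))^(v+1) * (v:ℝ)^(v+1) = ((v:ℝ)+1)^(v+1) := by
          rw [← mul_pow]; congr 1; field_simp
        rw [← e2]
        exact mul_le_mul_of_nonneg_right h2 (by positivity)
      rw [Nat.factorial_succ]
      push_cast
      have he := Real.exp_pos 1
      calc ((v:ℝ)+1) * v.factorial * Real.exp 1 ^ (v+1)
          = ((v:ℝ)+1) * Real.exp 1 * (v.factorial * Real.exp 1 ^ v) := by ring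
        _ ≤ ((v:ℝ)+1) * Real.exp 1 * (Real.exp 1 * (v:ℝ)^(v+1)) := by gcongr
        _ ≤ ((v:ℝ)+1) * Real.exp 1 * ((v:ℝ)+1)^(v+1) := by gcongr
        _ = _ := by ring

/-- log of factorial -/
lemma log_fact_le (v : ℕ) (hv : 0 < v) :
    Real.log (v.factorial : ℝ) ≤ v * Real.log v - v + 1 + Real.log v := by
  have hvr : (0:ℝ) < v := by exact_mod_cast hv
  have hf : (0:ℝ) < v.factorial := by exact_mod_cast v.factorial_pos
  have h := Real.log_le_log (by positivity) (fact_le v hv)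
  rw [Real.log_mul (by positivity) (by positivity), Real.log_mul (by positivity) (by positivity),
    Real.log_pow, Real.log_pow, Real.log_exp] at h
  push_cast at h
  linarith

lemma le_log_fact (v : ℕ) (hv : 0 < v) :
    v * Real.log v - v ≤ Real.log (v.factorial : ℝ) := by
  have hvr : (0:ℝ) < v := by exact_mod_cast hv
  have hf : (0:ℝ) < v.factorial := by exact_mod_cast v.factorial_pos
  have h2 := Real.pow_div_factorial_le_exp (v : ℝ) (by positivity) v
  have h := Real.log_le_log (by positivity) h2
  rw [Real.log_div (by positivity) (by positivity), Real.log_pow, Real.log_exp] at h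
  linarith

/-- entropy lower bound -/
lemma entropy_le (E v : ℕ) (hv : 0 < v) (hvE : v < E) :
    -(v * Real.log ((v:ℝ)/E) + ((E - v : ℕ):ℝ) * Real.log (1 - (v:ℝ)/E)) ≤
      Real.log (E.choose v : ℝ) + 2 + 2 * Real.log E := by
  have hE : 0 < E := by omega
  obtain ⟨u, rfl⟩ : ∃ u, E = v + u := ⟨E - v, by omega⟩
  have hu : 0 < u := by omega
  have hvr : (0:ℝ) < v := by exact_mod_cast hv
  have hur : (0:ℝ) < u := by exact_mod_cast hu
  have h1 := log_fact_le v hv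
  have h2 := log_fact_le u hu
  have h3 := le_log_fact (v+u) hE
  have hc : (((v+u).choose v : ℕ) : ℝ) * v.factorial * u.factorial = (v+u).factorial := by
    have := Nat.choose_mul_factorial_mul_factorial (n := v+u) (k := v) (by omega)
    rw [Nat.add_sub_cancel_left] at this
    exact_mod_cast this
  have hf1 : (0:ℝ) < v.factorial := by exact_mod_cast v.factorial_pos
  have hf2 : (0:ℝ) < u.factorial := by exact_mod_cast u.factorial_pos
  have hcp : (0:ℝ) < ((v+u).choose v : ℕ) := by exact_mod_cast Nat.choose_pos (by omega)
  rw [← hc, Real.log_mul (by positivity) (by positivity),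
    Real.log_mul (by positivity) (by positivity)] at h3
  rw [Nat.add_sub_cancel_left]
  push_cast at *
  have e1 : 1 - (v:ℝ)/(v+u) = u / (v+u) := by field_simp; ring
  rw [e1, Real.log_div (by positivity) (by positivity), Real.log_div (by positivity) (by positivity)]
  have h4 : Real.log v ≤ Real.log (v+u) := Real.log_le_log hvr (by linarith)
  have h5 : Real.log u ≤ Real.log (v+u) := Real.log_le_log hur (by linarith)
  linarith

lemma choose_mul_le_one (E v : ℕ) (h : v ≤ E) (x : ℝ) (hx : 0 ≤ x) (hx1 : x ≤ 1) :
    (E.choose v : ℝ) * (x ^ v * (1 - x) ^ (E - v)) ≤ 1 := by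
  have h1 := add_pow x (1 - x) E
  have hs : x + (1 - x) = 1 := by ring
  rw [hs, one_pow] at h1
  refine le_trans ?_ h1.symm.le
  have := Finset.single_le_sum (s := Finset.range (E+1)) (a := v)
    (f := fun m => x ^ m * (1 - x) ^ (E - m) * (E.choose m : ℝ))
    (fun m _ => by have : 0 ≤ 1 - x := by linarith
                   positivity) (by simp; omega)
  refine le_trans (le_of_eq ?_) this
  ring

end DGaux

namespace DGaux

lemma fekete (S : Set ℕ) (hS : S.Infinite) (hpos : ∀ n ∈ S, 0 < n) (f e : ℕ → ℝ)
    (he0 : ∀ n, 0 ≤ e n)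
    (he : Filter.Tendsto (fun n : ℕ => e n / n) Filter.atTop (nhds 0))
    (Bd : ℝ) (hB : ∀ n ∈ S, f n / n ≤ Bd)
    (hf : ∀ n₁ ∈ S, ∀ n₂ ∈ S, ∃ C : ℝ, ∀ k : ℕ,
      (k:ℝ) * (f n₁ - e n₁) - C ≤ f (k * n₁ + n₂)) :
    ∃ G, Filter.Tendsto (fun n : ℕ => f n / n) (Filter.atTop ⊓ Filter.principal S) (nhds G) := by
  let g : ℕ → ℝ := fun n => (f n - e n) / n
  have hgB : BddAbove (g '' S) := by
    refine ⟨Bd, ?_⟩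
    rintro _ ⟨n, hn, rfl⟩
    refine le_trans ?_ (hB n hn)
    have := he0 n
    show (f n - e n) / n ≤ f n / n
    gcongr; linarith
  refine ⟨sSup (g '' S), ?_⟩
  rw [tendsto_order]
  constructor
  · intro a ha
    obtain ⟨n₀, hn₀⟩ := hS.nonempty
    obtain ⟨_, ⟨n₁, hn₁, rfl⟩, hag⟩ := exists_lt_of_lt_csSup (Set.Nonempty.image g ⟨n₀, hn₀⟩) ha
    have hn₁p : 0 < n₁ := hpos n₁ hn₁
    have hn₁r : (0:ℝ) < n₁ := by exact_mod_cast hn₁p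
    -- constants per residue class
    have hC : ∀ c : ℕ, ∃ C : ℝ, ∀ n ∈ S, n % n₁ = c → n₁ * g n₁ * (n / n₁ : ℝ) - C ≤ f n := by
      intro c
      by_cases hex : ∃ n, n ∈ S ∧ n % n₁ = c
      · obtain ⟨hn2S, hn2c⟩ := Nat.find_spec hex
        set n₂ := Nat.find hex with hn₂
        obtain ⟨C, hC⟩ := hf n₁ hn₁ n₂ hn2S
        refine ⟨C + g n₁ * n₂ , ?_⟩
        intro n hn hnc
        have hle : n₂ ≤ n := Nat.find_min' hex ⟨hn, hnc⟩
        obtain ⟨k, hk⟩ : ∃ k, n = k * n₁ + n₂ := by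
          have : n₁ ∣ n - n₂ := (Nat.modEq_iff_dvd' hle).mp (by
            show n₂ % n₁ = n % n₁
            rw [hn2c, hnc])
          obtain ⟨k, hk⟩ := this
          exact ⟨k, by rw [mul_comm]; omega⟩
        have h := hC k
        rw [← hk] at h
        have e1 : (n₁:ℝ) * g n₁ = f n₁ - e n₁ := by
          show (n₁:ℝ) * ((f n₁ - e n₁) / n₁) = _
          field_simp
        have e2 : (n / n₁ : ℝ) = k + n₂ / n₁ := by
          rw [hk]; push_cast; field_simp
        rw [e2]
        rw [← e1] at h
        have e3 : (n₁:ℝ) * g n₁ * (k + n₂ / n₁) = k * (n₁ * g n₁) + g n₁ * n₂ := by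
          field_simp
        linarith
      · exact ⟨0, fun n hn hc => absurd ⟨n, hn, hc⟩ hex⟩
    choose C hC using hC
    obtain ⟨Cm, hCm⟩ : ∃ Cm : ℝ, ∀ c < n₁, C c ≤ Cm := by
      refine ⟨∑ c ∈ Finset.range n₁, |C c|, fun c hc => ?_⟩
      exact (le_abs_self _).trans (Finset.single_le_sum (f := fun c => |C c|)
        (fun _ _ => abs_nonneg _) (Finset.mem_range.mpr hc))
    have hlim : Filter.Tendsto (fun n : ℕ => g n₁ - Cm / n) Filter.atTop (nhds (g n₁ - 0)) :=
      tendsto_const_nhds.sub (tendsto_const_div_atTop_nhds_zero_nat Cm)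
    rw [sub_zero] at hlim
    have hev := (hlim.eventually (lt_mem_nhds hag)).filter_mono
      (inf_le_left : Filter.atTop ⊓ Filter.principal S ≤ Filter.atTop)
    have hevS : ∀ᶠ n in Filter.atTop ⊓ Filter.principal S, n ∈ S :=
      Filter.eventually_inf_principal.mpr (Filter.Eventually.of_forall fun n hn => hn)
    filter_upwards [hev, hevS] with n h1 hnS
    refine lt_of_lt_of_le h1 ?_
    have hnr : (0:ℝ) < n := by exact_mod_cast hpos n hnS
    have h2 := hC (n % n₁) n hnS rfl
    have h3 := hCm (n % n₁) (Nat.mod_lt _ hn₁p)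
    rw [le_div_iff₀ hnr]
    have e1 : (g n₁ - Cm / n) * n = g n₁ * n - Cm := by field_simp
    have e2 : (n₁:ℝ) * g n₁ * (n / n₁) = g n₁ * n := by field_simp
    rw [e1]; rw [e2] at h2; linarith
  · intro a ha
    have hlim : Filter.Tendsto (fun n : ℕ => sSup (g '' S) + e n / n) Filter.atTop
      (nhds (sSup (g '' S) + 0)) := tendsto_const_nhds.add he
    rw [add_zero] at hlim
    have hev := (hlim.eventually (gt_mem_nhds ha)).filter_mono
      (inf_le_left : Filter.atTop ⊓ Filter.principal S ≤ Filter.atTop)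
    have hevS : ∀ᶠ n in Filter.atTop ⊓ Filter.principal S, n ∈ S :=
      Filter.eventually_inf_principal.mpr (Filter.Eventually.of_forall fun n hn => hn)
    filter_upwards [hev, hevS] with n h1 hnS
    refine lt_of_le_of_lt ?_ h1
    have h2 : g n ≤ sSup (g '' S) := le_csSup hgB ⟨n, hnS, rfl⟩
    have e1 : f n / n = g n + e n / n := by
      show _ = (f n - e n) / n + e n / n
      ring
    linarith

lemma err_tendsto (c : ℝ) (hc : 0 < c) :
    Filter.Tendsto (fun n : ℕ => (3 * Real.log ((n:ℝ) / c + 1) + 2) / n) Filter.atTop (nhds 0) := by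
  have h1 : Filter.Tendsto (fun x : ℝ => Real.log x / x) Filter.atTop (nhds 0) :=
    Real.isLittleO_log_id_atTop.tendsto_div_nhds_zero
  have h2 : Filter.Tendsto (fun n : ℕ => (n:ℝ) / c + 1) Filter.atTop Filter.atTop :=
    Filter.tendsto_atTop_add_const_right _ _ (tendsto_natCast_atTop_atTop.atTop_div_const hc)
  have h3 := h1.comp h2
  have h4 : Filter.Tendsto (fun n : ℕ => 1 / c + 1 / (n:ℝ)) Filter.atTop (nhds (1 / c + 0)) :=
    tendsto_const_nhds.add (tendsto_const_div_atTop_nhds_zero_nat 1)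
  have h5 := ((h3.mul h4).const_mul 3).add (tendsto_const_div_atTop_nhds_zero_nat 2)
  simp only [zero_mul, mul_zero, add_zero] at h5
  refine h5.congr' ?_
  filter_upwards [Filter.eventually_gt_atTop 0] with n hn
  have hnr : (0:ℝ) < n := by exact_mod_cast hn
  simp only [Function.comp]
  field_simp

end DGaux

namespace DGLDPC
open DGaux

variable (M : DGLDPC)

lemma cf_Bpoly (t : Fin M.nv) (u v : ℕ) : cf (M.Bpoly t) u v = (M.B t u v : ℝ) := by
  unfold cf Bpoly
  rw [Polynomial.finsetSum_coeff]
  simp only [Polynomial.coeff_C_mul_X_pow]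
  by_cases hu : u ∈ Finset.range (M.kdim t + 1)
  · rw [Finset.sum_ite_eq, if_pos hu]
    simp only [Polynomial.finsetSum_coeff, Polynomial.coeff_C_mul_X_pow]
    by_cases hv : v ∈ Finset.range (M.q t + 1)
    · rw [Finset.sum_ite_eq, if_pos hv]
    · rw [Finset.sum_ite_eq, if_neg hv, M.hBsupp t u v]
      · simp
      · rintro ⟨_, rfl⟩; simp at hv
      · rintro ⟨_, _, _, h⟩; simp at hv; omega
  · rw [Finset.sum_ite_eq, if_neg hu, M.hBsupp t u v]
    · simp
    · rintro ⟨rfl, _⟩; simp at hu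
    · rintro ⟨_, h, _⟩; simp at hu; omega

lemma coeff_Apoly (t : Fin M.nc) (u : ℕ) : (M.Apoly t).coeff u = (M.A t u : ℝ) := by
  unfold Apoly
  simp only [Polynomial.finsetSum_coeff, Polynomial.coeff_C_mul_X_pow]
  by_cases hu : u ∈ Finset.range (M.s t + 1)
  · rw [Finset.sum_ite_eq, if_pos hu]
  · rw [Finset.sum_ite_eq, if_neg hu, M.hAsupp t u]
    · simp
    · rintro rfl; simp at hu
    · right; simp at hu; omega

lemma cf_CA (t : Fin M.nc) (u v : ℕ) :
    cf (Polynomial.C (M.Apoly t)) u v = if u = 0 then (M.A t v : ℝ) else 0 := by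
  unfold cf
  rw [Polynomial.coeff_C]
  split_ifs
  · rw [coeff_Apoly]
  · simp

noncomputable def PV (n : ℕ) : Polynomial (Polynomial ℝ) := ∏ t, M.Bpoly t ^ M.vExp n t
noncomputable def PC (n : ℕ) : Polynomial (Polynomial ℝ) :=
  ∏ t, (Polynomial.C (M.Apoly t)) ^ M.cExp n t

lemma Nv_eq (n u v : ℕ) : M.NvCount n u v = cf (M.PV n) u v := rfl
lemma Nc_eq (n v : ℕ) : M.NcCount n v = cf (M.PC n) 0 v := by
  unfold NcCount PC cf
  have : (∏ t, (Polynomial.C (M.Apoly t)) ^ M.cExp n t) =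
      Polynomial.C (∏ t, M.Apoly t ^ M.cExp n t) := by
    rw [map_prod]; simp
  rw [this, Polynomial.coeff_C_zero]

lemma NNB (t : Fin M.nv) : NN (M.Bpoly t) := fun i j => by rw [cf_Bpoly]; positivity
lemma NNA (t : Fin M.nc) : NN (Polynomial.C (M.Apoly t)) := fun i j => by
  rw [cf_CA]; split_ifs <;> positivity
lemma NNPV (n : ℕ) : NN (M.PV n) := NN.prod _ fun t => (M.NNB t).pow _
lemma NNPC (n : ℕ) : NN (M.PC n) := NN.prod _ fun t => (M.NNA t).pow _

/-- uniform bound on VN lengths/dimensions -/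
def Qm : ℕ := ∑ t, M.q t
def Km : ℕ := ∑ t, M.kdim t

lemma q_le (t : Fin M.nv) : M.q t ≤ M.Qm :=
  Finset.single_le_sum (f := M.q) (fun _ _ => Nat.zero_le _) (Finset.mem_univ t)
lemma k_le (t : Fin M.nv) : M.kdim t ≤ M.Km :=
  Finset.single_le_sum (f := M.kdim) (fun _ _ => Nat.zero_le _) (Finset.mem_univ t)

lemma Qm_pos : 0 < M.Qm := lt_of_lt_of_le (M.h_q1 ⟨0, M.hnv⟩) (M.q_le _)

lemma B_mem {t : Fin M.nv} {u v : ℕ} (h : M.B t u v ≠ 0) (h0 : ¬(u = 0 ∧ v = 0)) :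
    1 ≤ u ∧ u ≤ M.kdim t ∧ M.pd t ≤ v ∧ v ≤ M.q t := by
  by_contra hc
  exact h (M.hBsupp t u v h0 hc)

lemma supp_Q (n u v : ℕ) (h : M.NvCount n u v ≠ 0) : v ≤ M.Qm * u := by
  have : Sup (fun i j => j ≤ M.Qm * i) (M.PV n) := by
    have hadd : ∀ a b c d, b ≤ M.Qm * a → d ≤ M.Qm * c → b + d ≤ M.Qm * (a + c) := by
      intro a b c d h1 h2; rw [mul_add]; omega
    refine Sup.prod (by simp) hadd _ (fun t => Sup.pow (by simp) hadd ?_ _)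
    intro i j hij
    rw [cf_Bpoly] at hij
    by_cases h0 : i = 0 ∧ j = 0
    · simp [h0]
    · have := M.B_mem (by exact_mod_cast hij) h0
      have h2 := M.q_le t
      nlinarith
  exact this u v h

lemma supp_K (n u v : ℕ) (h : M.NvCount n u v ≠ 0) : u ≤ M.Km * v := by
  have : Sup (fun i j => i ≤ M.Km * j) (M.PV n) := by
    have hadd : ∀ a b c d, a ≤ M.Km * b → c ≤ M.Km * d → a + c ≤ M.Km * (b + d) := by
      intro a b c d h1 h2; rw [mul_add]; omega
    refine Sup.prod (by simp) hadd _ (fun t => Sup.pow (by simp) hadd ?_ _)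
    intro i j hij
    rw [cf_Bpoly] at hij
    by_cases h0 : i = 0 ∧ j = 0
    · simp [h0]
    · have := M.B_mem (by exact_mod_cast hij) h0
      have h2 := M.k_le t
      have h3 := M.h_pd2 t
      have : 1 ≤ j := by omega
      nlinarith
  exact this u v h

lemma intlam_pos : 0 < M.intlam := by
  unfold intlam
  have : Nonempty (Fin M.nv) := ⟨⟨0, M.hnv⟩⟩
  apply Finset.sum_pos _ Finset.univ_nonempty
  intro t _
  have := M.hlampos t
  have h2 : (0:ℝ) < M.q t := by exact_mod_cast M.h_q1 t
  positivity

lemma r_le (t : Fin M.nc) : M.r ≤ M.rd t := Nat.sInf_le ⟨t, rfl⟩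
lemma p_le (t : Fin M.nv) : M.p ≤ M.pd t := Nat.sInf_le ⟨t, rfl⟩
lemma r_attain : ∃ t, M.rd t = M.r := by
  have : M.r ∈ Set.range M.rd := Nat.sInf_mem ⟨_, ⟨⟨0, M.hnc⟩, rfl⟩⟩
  exact this
lemma r_ge : 2 ≤ M.r := by
  obtain ⟨t, ht⟩ := M.r_attain
  rw [← ht]; exact M.h_rd2 t

lemma r_sub_pos : (0:ℝ) < (M.r : ℝ) - 1 := by
  have : (2:ℝ) ≤ M.r := by exact_mod_cast M.r_ge
  linarith
lemma r_pos : (0:ℝ) < (M.r : ℝ) := by have := M.r_sub_pos; linarith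
lemma ψ_pos : 0 < M.ψ := div_pos M.r_pos M.r_sub_pos
lemma ψ_inv : 1 / M.ψ = 1 - 1 / (M.r : ℝ) := by
  have h1 := M.r_sub_pos
  have h2 := M.r_pos
  unfold ψ; field_simp

lemma Sminus_sub : M.Sminus ⊆ ((Finset.range (M.Km + 1) ×ˢ Finset.range (M.Qm + 1) : Finset (ℕ × ℕ)) : Set (ℕ × ℕ)) := by
  rintro ⟨i, j⟩ ⟨⟨t, ht⟩, h0⟩
  have := M.B_mem (t := t) (u := i) (v := j) (by simpa using Nat.pos_iff_ne_zero.mp ht) (by simpa using h0)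
  have h1 := M.k_le t
  have h2 := M.q_le t
  simp; omega

lemma Tset_finite : {x : ℝ | ∃ ij ∈ M.Sminus, x = M.Tij ij.1 ij.2}.Finite := by
  have : {x : ℝ | ∃ ij ∈ M.Sminus, x = M.Tij ij.1 ij.2} =
      (fun ij : ℕ × ℕ => M.Tij ij.1 ij.2) '' M.Sminus := by
    ext x; constructor
    · rintro ⟨ij, h, rfl⟩; exact ⟨ij, h, rfl⟩
    · rintro ⟨ij, h, rfl⟩; exact ⟨ij, h, rfl⟩
  rw [this]
  exact ((Finset.finite_toSet _).subset M.Sminus_sub).image _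

lemma T_attain : ∃ t i j, 0 < M.B t i j ∧ (i, j) ≠ (0, 0) ∧ M.T = M.Tij i j := by
  have hne : {x : ℝ | ∃ ij ∈ M.Sminus, x = M.Tij ij.1 ij.2}.Nonempty := by
    obtain ⟨u, hu⟩ := M.hBp ⟨0, M.hnv⟩
    refine ⟨_, (u, M.pd ⟨0, M.hnv⟩), ⟨⟨_, hu⟩, ?_⟩, rfl⟩
    have := M.h_pd2 ⟨0, M.hnv⟩
    intro h
    have := congrArg Prod.snd h
    simp at this; omega
  have := hne.csInf_mem M.Tset_finite
  obtain ⟨⟨i, j⟩, ⟨⟨t, ht⟩, h0⟩, h⟩ := this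
  exact ⟨t, i, j, ht, h0, h⟩

lemma T_le {t : Fin M.nv} {i j : ℕ} (h : 0 < M.B t i j) (h0 : (i, j) ≠ (0, 0)) :
    M.T ≤ M.Tij i j :=
  csInf_le M.Tset_finite.bddBelow ⟨(i, j), ⟨⟨t, h⟩, h0⟩, rfl⟩

lemma T_le' {t : Fin M.nv} {i j : ℕ} (h : 0 < M.B t i j) (h0 : (i, j) ≠ (0, 0)) :
    M.T * i + M.ψ ≤ j := by
  have h1 := M.T_le h h0
  have h2 := M.B_mem (t := t) (u := i) (v := j) h.ne' (by simpa using h0)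
  have h3 : (0:ℝ) < i := by exact_mod_cast h2.1
  unfold Tij at h1
  rw [le_div_iff₀ h3] at h1
  linarith

lemma T_pos (h : 2 < M.r ∨ 2 < M.p) : 0 < M.T := by
  obtain ⟨t, i, j, hB, h0, hT⟩ := M.T_attain
  have h2 := M.B_mem (t := t) (u := i) (v := j) hB.ne' (by simpa using h0)
  have h3 : (0:ℝ) < i := by exact_mod_cast h2.1
  rw [hT]
  unfold Tij
  apply div_pos _ h3
  have hr := M.r_sub_pos
  rw [sub_pos]
  unfold ψ
  rw [div_lt_iff₀ hr]
  rcases h with h | h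
  · have hj : (2:ℝ) ≤ j := by
      have := M.h_pd2 t
      exact_mod_cast (by omega : 2 ≤ j)
    have hr3 : (3:ℝ) ≤ M.r := by exact_mod_cast h
    nlinarith
  · have hj : (3:ℝ) ≤ j := by
      have := M.p_le t
      exact_mod_cast (by omega : 3 ≤ j)
    have hr3 : (2:ℝ) ≤ M.r := by exact_mod_cast M.r_ge
    nlinarith

/-- integrality -/
def II (n : ℕ) : Prop :=
  0 < n ∧ ((M.En n : ℝ) = (n : ℝ) / M.intlam) ∧
  (∀ t, (M.cExp n t : ℝ) = (M.En n : ℝ) * M.ρ t / (M.s t : ℝ)) ∧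
  (∀ t, (M.vExp n t : ℝ) = (M.En n : ℝ) * M.lam t / (M.q t : ℝ))

lemma adm_iff (α : ℝ) (n : ℕ) : M.Adm α n ↔ M.II n ∧
    ((⌊α * (n : ℝ)⌋₊ : ℝ) = α * (n : ℝ)) ∧ 0 < M.ENw n ⌊α * (n : ℝ)⌋₊ := by
  unfold Adm II; tauto

lemma comb_aux {α : ℝ} {n₁ n₂ : ℕ} (h1 : M.II n₁) (h2 : M.II n₂)
    (hw1 : (⌊α * (n₁ : ℝ)⌋₊ : ℝ) = α * (n₁ : ℝ)) (hw2 : (⌊α * (n₂ : ℝ)⌋₊ : ℝ) = α * (n₂ : ℝ)) (k : ℕ) :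
    M.II (k * n₁ + n₂) ∧ M.En (k * n₁ + n₂) = k * M.En n₁ + M.En n₂ ∧
    (∀ t, M.cExp (k * n₁ + n₂) t = k * M.cExp n₁ t + M.cExp n₂ t) ∧
    (∀ t, M.vExp (k * n₁ + n₂) t = k * M.vExp n₁ t + M.vExp n₂ t) ∧
    ⌊α * ((k * n₁ + n₂ : ℕ) : ℝ)⌋₊ = k * ⌊α * (n₁ : ℝ)⌋₊ + ⌊α * (n₂ : ℝ)⌋₊ ∧
    ((⌊α * ((k * n₁ + n₂ : ℕ) : ℝ)⌋₊ : ℝ) = α * ((k * n₁ + n₂ : ℕ) : ℝ)) := by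
  obtain ⟨p1, e1, c1, v1⟩ := h1
  obtain ⟨p2, e2, c2, v2⟩ := h2
  have hE : ((k * n₁ + n₂ : ℕ) : ℝ) / M.intlam = ((k * M.En n₁ + M.En n₂ : ℕ) : ℝ) := by
    push_cast; rw [e1, e2]; ring
  have hE' : M.En (k * n₁ + n₂) = k * M.En n₁ + M.En n₂ := by
    conv_lhs => unfold En
    rw [hE, Nat.floor_natCast]
  have hc : ∀ t, (M.En (k * n₁ + n₂) : ℝ) * M.ρ t / (M.s t : ℝ) =
      ((k * M.cExp n₁ t + M.cExp n₂ t : ℕ) : ℝ) := by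
    intro t; rw [hE']; push_cast; rw [c1, c2]; ring
  have hc' : ∀ t, M.cExp (k * n₁ + n₂) t = k * M.cExp n₁ t + M.cExp n₂ t := by
    intro t
    conv_lhs => unfold cExp
    rw [hc, Nat.floor_natCast]
  have hv : ∀ t, (M.En (k * n₁ + n₂) : ℝ) * M.lam t / (M.q t : ℝ) =
      ((k * M.vExp n₁ t + M.vExp n₂ t : ℕ) : ℝ) := by
    intro t; rw [hE']; push_cast; rw [v1, v2]; ring
  have hv' : ∀ t, M.vExp (k * n₁ + n₂) t = k * M.vExp n₁ t + M.vExp n₂ t := by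
    intro t
    conv_lhs => unfold vExp
    rw [hv, Nat.floor_natCast]
  have hw : α * ((k * n₁ + n₂ : ℕ) : ℝ) = ((k * ⌊α * (n₁ : ℝ)⌋₊ + ⌊α * (n₂ : ℝ)⌋₊ : ℕ) : ℝ) := by
    push_cast; rw [hw1, hw2]; ring
  have hw' : ⌊α * ((k * n₁ + n₂ : ℕ) : ℝ)⌋₊ = k * ⌊α * (n₁ : ℝ)⌋₊ + ⌊α * (n₂ : ℝ)⌋₊ := by
    rw [hw, Nat.floor_natCast]
  refine ⟨⟨by omega, ?_, ?_, ?_⟩, hE', hc', hv', hw', ?_⟩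
  · rw [hE, hE']
  · intro t; rw [hc, hc']
  · intro t; rw [hv, hv']
  · rw [hw', hw]

lemma PV_comb {n n₁ n₂ k : ℕ} (h : ∀ t, M.vExp n t = k * M.vExp n₁ t + M.vExp n₂ t) :
    M.PV n = M.PV n₁ ^ k * M.PV n₂ := by
  unfold PV
  rw [← Finset.prod_pow, ← Finset.prod_mul_distrib]
  apply Finset.prod_congr rfl
  intro t _
  rw [h, pow_add, mul_comm k, pow_mul]

lemma PC_comb {n n₁ n₂ k : ℕ} (h : ∀ t, M.cExp n t = k * M.cExp n₁ t + M.cExp n₂ t) :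
    M.PC n = M.PC n₁ ^ k * M.PC n₂ := by
  unfold PC
  rw [← Finset.prod_pow, ← Finset.prod_mul_distrib]
  apply Finset.prod_congr rfl
  intro t _
  rw [h, pow_add, mul_comm k, pow_mul]

lemma cf_comb {P Q : Polynomial (Polynomial ℝ)} (hP : NN P) (hQ : NN Q) (k a b c d : ℕ) :
    cf P a b ^ k * cf Q c d ≤ cf (P ^ k * Q) (k * a + c) (k * b + d) :=
  le_trans (mul_le_mul_of_nonneg_right (cf_pow_ge hP a b k) (hQ _ _))
    (cf_mul_ge (hP.pow k) hQ _ _ _ _)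

noncomputable def term (n w v : ℕ) : ℝ :=
  M.NvCount n w v * M.NcCount n v / ((M.En n).choose v : ℝ)

lemma Nv_nn (n w v : ℕ) : 0 ≤ M.NvCount n w v := by rw [Nv_eq]; exact M.NNPV n _ _
lemma Nc_nn (n v : ℕ) : 0 ≤ M.NcCount n v := by rw [Nc_eq]; exact M.NNPC n _ _

lemma term_nn (n w v : ℕ) : 0 ≤ M.term n w v := by
  unfold term
  have := M.Nv_nn n w v
  have := M.Nc_nn n v
  positivity

lemma term_le (n w v : ℕ) (hv : v ≤ M.En n) : M.term n w v ≤ M.ENw n w := by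
  unfold ENw
  exact Finset.single_le_sum (f := fun v => M.term n w v) (fun v _ => M.term_nn n w v)
    (Finset.mem_range.mpr (by omega))

lemma ENw_le (n w : ℕ) (b : ℝ) (hb : ∀ v ≤ M.En n, M.term n w v ≤ b) :
    M.ENw n w ≤ ((M.En n : ℝ) + 1) * b := by
  have : M.ENw n w ≤ ∑ v ∈ Finset.range (M.En n + 1), b :=
    Finset.sum_le_sum fun v hv => hb v (by have := Finset.mem_range.mp hv; omega)
  simpa using this

lemma exists_term (n w : ℕ) : ∃ v ≤ M.En n, M.ENw n w ≤ ((M.En n : ℝ) + 1) * M.term n w v := by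
  obtain ⟨v, hv, hmax⟩ := Finset.exists_max_image (Finset.range (M.En n + 1))
    (fun v => M.term n w v) ⟨0, by simp⟩
  refine ⟨v, by have := Finset.mem_range.mp hv; omega, ?_⟩
  exact M.ENw_le n w _ (fun v' hv' => hmax v' (Finset.mem_range.mpr (by omega)))

end DGLDPC

namespace DGLDPC
open DGaux

variable (M : DGLDPC)

noncomputable def err (n : ℕ) : ℝ := 3 * Real.log ((n:ℝ) / M.intlam + 1) + 2

lemma E_pos {n : ℕ} (h : M.II n) : 0 < M.En n := by
  have h1 : (0:ℝ) < n := by exact_mod_cast h.1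
  have h2 := M.intlam_pos
  have h3 := h.2.1
  have : (0:ℝ) < M.En n := by rw [h3]; positivity
  exact_mod_cast this

lemma good_term {α : ℝ} (hα : 0 < α) {n : ℕ} (hn : M.Adm α n) :
    ∃ v ≤ M.En n, 0 < v ∧ v ≤ M.Qm * ⌊α * (n:ℝ)⌋₊ ∧
      0 < M.NvCount n ⌊α * (n:ℝ)⌋₊ v ∧ 0 < M.NcCount n v ∧
      M.ENw n ⌊α * (n:ℝ)⌋₊ ≤ ((M.En n : ℝ) + 1) * M.term n ⌊α * (n:ℝ)⌋₊ v := by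
  rw [adm_iff] at hn
  obtain ⟨hI, hw, hE⟩ := hn
  obtain ⟨v, hv, hle⟩ := M.exists_term n ⌊α * (n:ℝ)⌋₊
  have hE1 : (0:ℝ) < (M.En n : ℝ) + 1 := by positivity
  have ht : 0 < M.term n ⌊α * (n:ℝ)⌋₊ v := by
    by_contra hc
    have h0 : M.term n ⌊α * (n:ℝ)⌋₊ v = 0 := le_antisymm (not_lt.mp hc) (M.term_nn _ _ _)
    rw [h0, mul_zero] at hle; linarith
  have hNv : M.NvCount n ⌊α * (n:ℝ)⌋₊ v ≠ 0 := by
    intro h0; unfold term at ht; rw [h0] at ht; simp at ht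
  have hNc : M.NcCount n v ≠ 0 := by
    intro h0; unfold term at ht; rw [h0] at ht; simp at ht
  refine ⟨v, hv, ?_, M.supp_Q _ _ _ hNv, lt_of_le_of_ne (M.Nv_nn _ _ _) hNv.symm,
    lt_of_le_of_ne (M.Nc_nn _ _) hNc.symm, hle⟩
  have h2 := M.supp_K _ _ _ hNv
  have h3 : 0 < ⌊α * (n:ℝ)⌋₊ := by
    have : (0:ℝ) < n := by exact_mod_cast hI.1
    have : (0:ℝ) < (⌊α * (n:ℝ)⌋₊ : ℝ) := by rw [hw]; positivity
    exact_mod_cast this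
  rcases Nat.eq_zero_or_pos v with rfl | h
  · omega
  · exact h

lemma fek_ineq {α : ℝ} (hα : 0 < α) (hβ : M.Qm * M.intlam * α < 1) {n₁ n₂ : ℕ}
    (h1 : M.Adm α n₁) (h2 : M.Adm α n₂) : ∃ C : ℝ, ∀ k : ℕ,
      (k:ℝ) * (Real.log (M.ENw n₁ ⌊α * (n₁ : ℝ)⌋₊) - M.err n₁) - C ≤
        Real.log (M.ENw (k * n₁ + n₂) ⌊α * ((k * n₁ + n₂ : ℕ) : ℝ)⌋₊) := by
  obtain ⟨v₁, hv₁E, hv₁, hv₁Q, hNv₁, hNc₁, ht₁⟩ := M.good_term hα h1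
  obtain ⟨v₂, hv₂E, hv₂, hv₂Q, hNv₂, hNc₂, ht₂⟩ := M.good_term hα h2
  rw [adm_iff] at h1 h2
  obtain ⟨hI1, hw1, hE1⟩ := h1
  obtain ⟨hI2, hw2, hE2⟩ := h2
  have hlam := M.intlam_pos
  have hEp := M.E_pos hI1
  have hEr : (0:ℝ) < M.En n₁ := by exact_mod_cast hEp
  have hv₁r : (0:ℝ) < v₁ := by exact_mod_cast hv₁
  have hv₁lt : v₁ < M.En n₁ := by
    have a : (v₁:ℝ) ≤ M.Qm * (α * n₁) := by rw [← hw1]; exact_mod_cast hv₁Q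
    have b : (n₁:ℝ) = M.En n₁ * M.intlam := by rw [hI1.2.1]; field_simp
    have : (v₁:ℝ) < M.En n₁ := by
      rw [b] at a
      calc (v₁:ℝ) ≤ (M.Qm * M.intlam * α) * M.En n₁ := by linarith
        _ < 1 * M.En n₁ := by gcongr
        _ = _ := one_mul _
    exact_mod_cast this
  set x : ℝ := (v₁:ℝ) / M.En n₁ with hx
  have hx0 : 0 < x := by positivity
  have hx1 : x < 1 := by
    rw [hx, div_lt_one hEr]; exact_mod_cast hv₁lt
  have hx1' : 0 < 1 - x := by linarith
  set w₁ := ⌊α * (n₁ : ℝ)⌋₊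
  set w₂ := ⌊α * (n₂ : ℝ)⌋₊
  set a₁ := M.NvCount n₁ w₁ v₁ * M.NcCount n₁ v₁ with ha₁
  set a₂ := M.NvCount n₂ w₂ v₂ * M.NcCount n₂ v₂ with ha₂
  have ha₁p : 0 < a₁ := mul_pos hNv₁ hNc₁
  have ha₂p : 0 < a₂ := mul_pos hNv₂ hNc₂
  -- bound for block one
  have hblock : Real.log (M.ENw n₁ w₁) - M.err n₁ ≤
      Real.log a₁ + v₁ * Real.log x + ((M.En n₁ - v₁ : ℕ):ℝ) * Real.log (1 - x) := by
    have hent := entropy_le (M.En n₁) v₁ hv₁ hv₁lt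
    rw [← hx] at hent
    have hch : (0:ℝ) < ((M.En n₁).choose v₁ : ℝ) := by exact_mod_cast Nat.choose_pos hv₁E
    have hl := Real.log_le_log hE1 ht₁
    unfold term at hl
    rw [← ha₁, Real.log_mul (by positivity) (by positivity),
      Real.log_div (by positivity) (by positivity)] at hl
    unfold err
    rw [← hI1.2.1]
    have : Real.log (M.En n₁ : ℝ) ≤ Real.log ((M.En n₁ : ℝ) + 1) :=
      Real.log_le_log hEr (by linarith)
    linarith
  refine ⟨-(Real.log a₂ + v₂ * Real.log x + ((M.En n₂ - v₂ : ℕ):ℝ) * Real.log (1 - x)), ?_⟩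
  intro k
  obtain ⟨hI, hEn, hc, hv, hw, hw'⟩ := M.comb_aux hI1 hI2 hw1 hw2 k
  set n := k * n₁ + n₂
  have hvE : k * v₁ + v₂ ≤ M.En n := by
    rw [hEn]; exact add_le_add (Nat.mul_le_mul_left k hv₁E) hv₂E
  have hsub : M.En n - (k * v₁ + v₂) = k * (M.En n₁ - v₁) + (M.En n₂ - v₂) := by
    rw [hEn]
    obtain ⟨u₁, hu₁⟩ := Nat.exists_eq_add_of_le hv₁E
    obtain ⟨u₂, hu₂⟩ := Nat.exists_eq_add_of_le hv₂E
    rw [hu₁, hu₂, Nat.add_sub_cancel_left, Nat.add_sub_cancel_left, mul_add]; omega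
  have hch : (0:ℝ) < ((M.En n).choose (k * v₁ + v₂) : ℝ) := by exact_mod_cast Nat.choose_pos hvE
  have hchoose := choose_mul_le_one (M.En n) (k * v₁ + v₂) hvE x hx0.le hx1.le
  have hNv : M.NvCount n₁ w₁ v₁ ^ k * M.NvCount n₂ w₂ v₂ ≤ M.NvCount n (k * w₁ + w₂) (k * v₁ + v₂) := by
    simp only [Nv_eq]
    rw [M.PV_comb hv]
    exact cf_comb (M.NNPV _) (M.NNPV _) _ _ _ _ _
  have hNc : M.NcCount n₁ v₁ ^ k * M.NcCount n₂ v₂ ≤ M.NcCount n (k * v₁ + v₂) := by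
    simp only [Nc_eq]
    rw [M.PC_comb hc]
    have := cf_comb (M.NNPC n₁) (M.NNPC n₂) k 0 v₁ 0 v₂
    simpa using this
  have hprod : a₁ ^ k * a₂ ≤ M.NvCount n (k * w₁ + w₂) (k * v₁ + v₂) * M.NcCount n (k * v₁ + v₂) := by
    have := mul_le_mul hNv hNc (by positivity) (M.Nv_nn _ _ _)
    refine le_trans (le_of_eq ?_) this
    rw [ha₁, ha₂, mul_pow]; ring
  have hlow : a₁ ^ k * a₂ * (x ^ (k * v₁ + v₂) * (1 - x) ^ (M.En n - (k * v₁ + v₂))) ≤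
      M.ENw n (k * w₁ + w₂) := by
    refine le_trans ?_ (M.term_le n (k * w₁ + w₂) _ hvE)
    unfold term
    rw [le_div_iff₀ hch]
    have hpos : 0 ≤ a₁ ^ k * a₂ := by positivity
    calc _ = a₁ ^ k * a₂ * (((M.En n).choose (k * v₁ + v₂) : ℝ) * (x ^ (k * v₁ + v₂) * (1 - x) ^ (M.En n - (k * v₁ + v₂)))) := by ring
      _ ≤ a₁ ^ k * a₂ * 1 := by gcongr
      _ ≤ _ := by rw [mul_one]; exact hprod
  rw [hw]
  clear_value a₁ a₂
  refine le_trans ?_ (Real.log_le_log (by positivity) hlow)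
  rw [Real.log_mul (by positivity) (by positivity), Real.log_mul (by positivity) (by positivity),
    Real.log_mul (by positivity) (by positivity), Real.log_pow, Real.log_pow, Real.log_pow, hsub]
  push_cast [Nat.cast_add, Nat.cast_mul] 
  have := mul_le_mul_of_nonneg_left hblock (Nat.cast_nonneg (α := ℝ) k)
  push_cast at this
  linarith

noncomputable def KB : ℝ := ∑ t, ∑ u ∈ Finset.range (M.kdim t + 1), ∑ v ∈ Finset.range (M.q t + 1), (M.B t u v : ℝ)
noncomputable def KA : ℝ := ∑ t, ∑ u ∈ Finset.range (M.s t + 1), (M.A t u : ℝ)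

lemma KB_nn : 0 ≤ M.KB := by unfold KB; positivity
lemma KA_nn : 0 ≤ M.KA := by unfold KA; positivity

lemma evalB (t : Fin M.nv) (x y β : ℝ) (hβ : 0 ≤ β)
    (h : ∀ i j, 0 < M.B t i j → (i, j) ≠ (0, 0) → x ^ i * y ^ j ≤ β) :
    Polynomial.evalEval y x (M.Bpoly t) ≤ Real.exp (M.KB * β) := by
  have e : Polynomial.evalEval y x (M.Bpoly t) = ∑ u ∈ Finset.range (M.kdim t + 1),
      ∑ v ∈ Finset.range (M.q t + 1), (M.B t u v : ℝ) * (x ^ u * y ^ v) := by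
    unfold Bpoly Polynomial.evalEval
    simp only [Polynomial.eval_finsetSum, Polynomial.eval_mul, Polynomial.eval_C,
      Polynomial.eval_pow, Polynomial.eval_X, Finset.sum_mul]
    refine Finset.sum_congr rfl fun u _ => Finset.sum_congr rfl fun v _ => by ring
  rw [e]
  have h1 : ∑ u ∈ Finset.range (M.kdim t + 1),
      ∑ v ∈ Finset.range (M.q t + 1), (M.B t u v : ℝ) * (x ^ u * y ^ v) ≤
      ∑ u ∈ Finset.range (M.kdim t + 1), ∑ v ∈ Finset.range (M.q t + 1),
        ((if u = 0 then (if v = 0 then (1:ℝ) else 0) else 0) + (M.B t u v : ℝ) * β) := by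
    refine Finset.sum_le_sum fun u _ => Finset.sum_le_sum fun v _ => ?_
    by_cases h0 : u = 0 ∧ v = 0
    · obtain ⟨rfl, rfl⟩ := h0
      simp [M.hB00 t, hβ]
    · have hd : (0:ℝ) ≤ (if u = 0 then (if v = 0 then (1:ℝ) else 0) else 0) := by
        split_ifs <;> norm_num
      rcases Nat.eq_zero_or_pos (M.B t u v) with hz | hp
      · rw [hz]; simpa using hd
      · have := h u v hp (by simpa using h0)
        have h3 := mul_le_mul_of_nonneg_left this (Nat.cast_nonneg (α := ℝ) (M.B t u v))
        linarith
  have h2 : ∑ u ∈ Finset.range (M.kdim t + 1), ∑ v ∈ Finset.range (M.q t + 1),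
        ((if u = 0 then (if v = 0 then (1:ℝ) else 0) else 0) + (M.B t u v : ℝ) * β) =
      1 + (∑ u ∈ Finset.range (M.kdim t + 1), ∑ v ∈ Finset.range (M.q t + 1), (M.B t u v : ℝ)) * β := by
    simp only [Finset.sum_add_distrib, Finset.sum_mul]
    congr 1
    rw [Finset.sum_eq_single 0]
    · simp
    · intro b _ hb; simp [hb]
    · simp
  have h3 : (∑ u ∈ Finset.range (M.kdim t + 1), ∑ v ∈ Finset.range (M.q t + 1), (M.B t u v : ℝ)) ≤ M.KB :=
    Finset.single_le_sum (f := fun t => ∑ u ∈ Finset.range (M.kdim t + 1), ∑ v ∈ Finset.range (M.q t + 1), (M.B t u v : ℝ))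
      (fun _ _ => by positivity) (Finset.mem_univ t)
  have h4 := Real.add_one_le_exp (M.KB * β)
  have h5 := mul_le_mul_of_nonneg_right h3 hβ
  linarith

lemma evalA (t : Fin M.nc) (x y β : ℝ) (hβ : 0 ≤ β)
    (h : ∀ i, M.r ≤ i → y ^ i ≤ β) :
    Polynomial.evalEval y x (Polynomial.C (M.Apoly t)) ≤ Real.exp (M.KA * β) := by
  have e : Polynomial.evalEval y x (Polynomial.C (M.Apoly t)) = ∑ u ∈ Finset.range (M.s t + 1),
      (M.A t u : ℝ) * y ^ u := by
    unfold Apoly Polynomial.evalEval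
    simp only [Polynomial.eval_finsetSum, Polynomial.eval_mul, Polynomial.eval_C,
      Polynomial.eval_pow, Polynomial.eval_X]
  rw [e]
  have h1 : ∑ u ∈ Finset.range (M.s t + 1), (M.A t u : ℝ) * y ^ u ≤
      ∑ u ∈ Finset.range (M.s t + 1), ((if u = 0 then (1:ℝ) else 0) + (M.A t u : ℝ) * β) := by
    refine Finset.sum_le_sum fun u _ => ?_
    by_cases h0 : u = 0
    · subst h0
      simp [M.hA0 t, hβ]
    · simp only [h0, if_false, zero_add]
      rcases Nat.lt_or_ge u (M.rd t) with hz | hp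
      · rw [M.hAsupp t u h0 (Or.inl hz)]; simp
      · have := h u ((M.r_le t).trans hp)
        exact mul_le_mul_of_nonneg_left this (Nat.cast_nonneg (α := ℝ) (M.A t u))
  have h2 : ∑ u ∈ Finset.range (M.s t + 1), ((if u = 0 then (1:ℝ) else 0) + (M.A t u : ℝ) * β) =
      1 + (∑ u ∈ Finset.range (M.s t + 1), (M.A t u : ℝ)) * β := by
    simp only [Finset.sum_add_distrib, Finset.sum_mul]
    congr 1
    simp
  have h3 : (∑ u ∈ Finset.range (M.s t + 1), (M.A t u : ℝ)) ≤ M.KA :=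
    Finset.single_le_sum (f := fun t => ∑ u ∈ Finset.range (M.s t + 1), (M.A t u : ℝ))
      (fun _ _ => by positivity) (Finset.mem_univ t)
  have h4 := Real.add_one_le_exp (M.KA * β)
  have h5 := mul_le_mul_of_nonneg_right h3 hβ
  linarith

lemma evalEval_nn {P : Polynomial (Polynomial ℝ)} (hP : NN P) {x y : ℝ} (hx : 0 ≤ x) (hy : 0 ≤ y) :
    0 ≤ Polynomial.evalEval y x P := by
  have h1 := cf_le_eval hP hx hy 0 0
  have h2 := hP 0 0
  simp at h1; linarith

lemma sum_vExp {n : ℕ} (h : M.II n) : ∑ t, (M.vExp n t : ℝ) = n := by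
  have h0 := M.intlam_pos
  simp_rw [h.2.2.2, mul_div_assoc]
  rw [← Finset.mul_sum, h.2.1]
  show (n:ℝ) / M.intlam * M.intlam = n
  field_simp

lemma sum_cExp {n : ℕ} (h : M.II n) : ∑ t, (M.cExp n t : ℝ) ≤ M.En n := by
  simp_rw [h.2.2.1, mul_div_assoc]
  rw [← Finset.mul_sum]
  have : ∑ t, M.ρ t / (M.s t : ℝ) ≤ ∑ t, M.ρ t := by
    refine Finset.sum_le_sum fun t _ => ?_
    apply div_le_self (M.hρpos t).le
    have := M.h_hs t
    exact_mod_cast (by omega : 1 ≤ M.s t)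
  rw [M.hρsum] at this
  calc _ ≤ (M.En n : ℝ) * 1 := by gcongr
    _ = _ := mul_one _

lemma prod_exp_le {ι : Type*} [Fintype ι] (a : ι → ℝ) (e : ι → ℕ) (c : ℝ)
    (h0 : ∀ t, 0 ≤ a t) (h : ∀ t, a t ≤ Real.exp c) :
    ∏ t, a t ^ e t ≤ Real.exp (c * ∑ t, (e t : ℝ)) := by
  rw [Finset.mul_sum, Real.exp_sum]
  refine Finset.prod_le_prod (fun t _ => pow_nonneg (h0 t) _) fun t _ => ?_
  rw [mul_comm, Real.exp_nat_mul]
  exact pow_le_pow_left₀ (h0 t) (h t) _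

noncomputable def K1 : ℝ := M.KB * M.Qm * M.intlam + M.KA * M.Qm

lemma term_upper {α : ℝ} (hα : 0 < α) (hβ : M.Qm * M.intlam * α ≤ 1) {n : ℕ} (hI : M.II n)
    (hw : (⌊α * (n : ℝ)⌋₊ : ℝ) = α * (n : ℝ)) (v : ℕ) (hvE : v ≤ M.En n) :
    M.term n ⌊α * (n : ℝ)⌋₊ v ≤
      Real.exp (α * n * (M.K1 + M.T / M.ψ * Real.log (M.Qm * M.intlam * α))) := by
  by_cases hNv : M.NvCount n ⌊α * (n : ℝ)⌋₊ v = 0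
  · unfold term; rw [hNv]; simp [Real.exp_nonneg]
  have hvQ := M.supp_Q _ _ _ hNv
  set w := ⌊α * (n : ℝ)⌋₊ with hwdef
  set β := M.Qm * M.intlam * α with hβdef
  have hlam := M.intlam_pos
  have hQ : (0:ℝ) < M.Qm := by exact_mod_cast M.Qm_pos
  have hβ0 : 0 < β := by positivity
  have hE := M.E_pos hI
  have hEr : (0:ℝ) < M.En n := by exact_mod_cast hE
  have hn : (n:ℝ) = M.En n * M.intlam := by rw [hI.2.1]; field_simp
  set L := Real.log β with hL
  have hL0 : L ≤ 0 := Real.log_nonpos hβ0.le hβ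
  have hexpL : Real.exp L = β := Real.exp_log hβ0
  have hψ := M.ψ_pos
  have hr := M.r_pos
  have hψi := M.ψ_inv
  set x := Real.exp (-(M.T / M.ψ) * L) with hx
  set y := Real.exp (L / M.ψ) with hy
  set z := Real.exp (L / M.r) with hz
  have hvβ : (v:ℝ) ≤ β * M.En n := by
    have : (v:ℝ) ≤ M.Qm * w := by exact_mod_cast hvQ
    rw [hw, hn] at this
    rw [hβdef]; linarith
  -- VN part
  have hV : M.NvCount n w v * (x ^ w * y ^ v) ≤ Real.exp (M.KB * β * n) := by
    rw [Nv_eq]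
    refine (cf_le_eval (M.NNPV n) (Real.exp_nonneg _) (Real.exp_nonneg _) w v).trans ?_
    unfold PV
    rw [evalEval_prod_pow, ← M.sum_vExp hI]
    refine prod_exp_le _ _ _ (fun t => evalEval_nn (M.NNB t) (Real.exp_nonneg _) (Real.exp_nonneg _))
      (fun t => M.evalB t _ _ β hβ0.le ?_)
    intro i j hB h0
    have hT := M.T_le' hB h0
    rw [← Real.exp_nat_mul, ← Real.exp_nat_mul, ← Real.exp_add]
    conv_rhs => rw [← hexpL]
    apply Real.exp_le_exp.mpr
    have e1 : (i:ℝ) * (-(M.T / M.ψ) * L) + j * (L / M.ψ) = (j - M.T * i) / M.ψ * L := by ring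
    rw [e1]
    have : 1 ≤ (j - M.T * i) / M.ψ := by rw [le_div_iff₀ hψ]; linarith
    nlinarith
  have hC : M.NcCount n v * z ^ v ≤ Real.exp (M.KA * β * M.En n) := by
    rw [Nc_eq]
    have h1 := cf_le_eval (M.NNPC n) (zero_le_one) (Real.exp_nonneg (L / M.r)) 0 v
    rw [pow_zero, one_mul] at h1
    refine h1.trans ?_
    unfold PC
    rw [evalEval_prod_pow]
    refine (prod_exp_le _ _ (M.KA * β) (fun t => evalEval_nn (M.NNA t) zero_le_one (Real.exp_nonneg _))
      (fun t => M.evalA t _ _ β hβ0.le ?_)).trans ?_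
    · intro i hi
      rw [← Real.exp_nat_mul]
      conv_rhs => rw [← hexpL]
      apply Real.exp_le_exp.mpr
      have hir : (M.r:ℝ) ≤ i := by exact_mod_cast hi
      have e1 : (i:ℝ) * (L / M.r) = i / M.r * L := by ring
      rw [e1]
      have : 1 ≤ (i:ℝ) / M.r := by rw [le_div_iff₀ hr]; linarith
      nlinarith
    · apply Real.exp_le_exp.mpr
      have := M.KA_nn
      exact mul_le_mul_of_nonneg_left (M.sum_cExp hI) (by positivity)
  have hch : (0:ℝ) < ((M.En n).choose v : ℝ) := by exact_mod_cast Nat.choose_pos hvE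
  have hchoose : Real.exp (-(v * L)) ≤ ((M.En n).choose v : ℝ) := by
    rcases Nat.eq_zero_or_pos v with rfl | hv0
    · simp
    · refine le_trans ?_ (choose_ge _ _ hv0 hvE)
      have hvr : (0:ℝ) < v := by exact_mod_cast hv0
      have e1 : Real.exp (-(v * L)) = (1 / β) ^ v := by
        rw [← mul_neg, Real.exp_nat_mul, Real.exp_neg, hexpL, one_div]
      rw [e1]
      apply pow_le_pow_left₀ (by positivity)
      rw [div_le_div_iff₀ hβ0 hvr]; linarith
  unfold term
  rw [div_le_iff₀ hch]
  have hxw : 0 < x ^ w * y ^ v := by positivity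
  have hzv : 0 < z ^ v := by positivity
  have key : M.NvCount n w v * M.NcCount n v ≤
      Real.exp (M.KB * β * n) * Real.exp (M.KA * β * M.En n) / (x ^ w * y ^ v * z ^ v) := by
    rw [le_div_iff₀ (by positivity)]
    have := mul_le_mul hV hC (mul_nonneg (M.Nc_nn _ _) hzv.le) (Real.exp_nonneg _)
    refine le_trans (le_of_eq ?_) this
    ring
  refine key.trans ?_
  refine le_trans ?_ (mul_le_mul_of_nonneg_left hchoose (Real.exp_nonneg _))
  rw [hx, hy, hz, ← Real.exp_nat_mul, ← Real.exp_nat_mul, ← Real.exp_nat_mul,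
    ← Real.exp_add, ← Real.exp_add, ← Real.exp_add, ← Real.exp_sub, ← Real.exp_add]
  apply Real.exp_le_exp.mpr
  apply le_of_eq
  rw [hw]
  have e2 : L / M.ψ = L * (1 - 1 / (M.r:ℝ)) := by rw [← hψi]; ring
  rw [e2]
  have e3 : M.KB * β * n + M.KA * β * M.En n = α * n * M.K1 := by
    unfold K1; rw [hβdef, hn]; ring
  rw [e3]
  ring

lemma gr_upper {α : ℝ} (hα : 0 < α) (hβ : M.Qm * M.intlam * α ≤ 1) {n : ℕ} (h : M.Adm α n) :
    Real.log (M.ENw n ⌊α * (n : ℝ)⌋₊) / n ≤ M.err n / n +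
      (α * (M.K1 + M.T / M.ψ * Real.log (M.Qm * M.intlam)) + M.T / M.ψ * α * Real.log α) := by
  rw [adm_iff] at h
  obtain ⟨hI, hw, hE⟩ := h
  have hn : (0:ℝ) < n := by exact_mod_cast hI.1
  have hlam := M.intlam_pos
  have hQ : (0:ℝ) < M.Qm := by exact_mod_cast M.Qm_pos
  have h1 := M.ENw_le n _ _ (fun v hv => M.term_upper hα hβ hI hw v hv)
  have h2 := Real.log_le_log hE h1
  rw [Real.log_mul (by positivity) (Real.exp_ne_zero _), Real.log_exp, Real.log_mul (by positivity) (by positivity)] at h2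
  rw [div_le_iff₀ hn]
  have e1 : (M.err n / n + (α * (M.K1 + M.T / M.ψ * Real.log (M.Qm * M.intlam)) + M.T / M.ψ * α * Real.log α)) * n
    = M.err n + α * n * (M.K1 + M.T / M.ψ * (Real.log (M.Qm * M.intlam) + Real.log α)) := by
    field_simp; ring
  rw [e1]
  refine h2.trans ?_
  have : Real.log ((M.En n : ℝ) + 1) ≤ M.err n := by
    unfold err
    rw [← hI.2.1]
    have : 0 ≤ Real.log ((M.En n : ℝ) + 1) := Real.log_nonneg (by
      have : (0:ℝ) ≤ M.En n := Nat.cast_nonneg _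
      linarith)
    linarith
  linarith

end DGLDPC

namespace DGLDPC
open DGaux

variable (M : DGLDPC)

lemma Nv_lower (t : Fin M.nv) (i j : ℕ) (hB : 0 < M.B t i j) (h0 : (i, j) ≠ (0, 0)) (n m : ℕ) :
    ((M.vExp n t).choose m : ℝ) ≤ M.NvCount n (m * i) (m * j) := by
  rw [Nv_eq]
  have h0' : ¬(i = 0 ∧ j = 0) := by simpa using h0
  have hR : ∀ a b, cf (M.Bpoly t - 1) a b = (M.B t a b : ℝ) - (if a = 0 ∧ b = 0 then 1 else 0) := by
    intro a b
    have := cf_add (M.Bpoly t - 1) 1 a b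
    rw [sub_add_cancel, cf_one, cf_Bpoly] at this
    linarith
  have hNN : NN (M.Bpoly t - 1) := by
    intro a b
    rw [hR]
    by_cases h : a = 0 ∧ b = 0
    · obtain ⟨rfl, rfl⟩ := h
      simp [M.hB00 t]
    · simp [h]
  have h1 : 1 ≤ cf (M.Bpoly t - 1) i j := by
    rw [hR, if_neg h0', sub_zero]; exact_mod_cast hB
  have h2 := cf_choose hNN i j h1 (M.vExp n t) m
  rw [add_sub_cancel] at h2
  refine h2.trans ?_
  unfold PV
  exact cf_prod_ge M.Bpoly M.NNB (fun t => by rw [cf_Bpoly, M.hB00]; simp) (M.vExp n) t _ _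

lemma Nc_lower (t : Fin M.nc) (ht : M.rd t = M.r) (n m : ℕ) :
    ((M.cExp n t).choose m : ℝ) ≤ M.NcCount n (m * M.r) := by
  rw [Nc_eq]
  have hr := M.r_ge
  have hR : ∀ a b, cf (Polynomial.C (M.Apoly t) - 1) a b =
      (if a = 0 then (M.A t b : ℝ) else 0) - (if a = 0 ∧ b = 0 then 1 else 0) := by
    intro a b
    have := cf_add (Polynomial.C (M.Apoly t) - 1) 1 a b
    rw [sub_add_cancel, cf_one, cf_CA] at this
    linarith
  have hNN : NN (Polynomial.C (M.Apoly t) - 1) := by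
    intro a b
    rw [hR]
    by_cases ha : a = 0
    · by_cases hb : b = 0
      · simp [ha, hb, M.hA0 t]
      · simp [ha, hb]
    · simp [ha]
  have h1 : 1 ≤ cf (Polynomial.C (M.Apoly t) - 1) 0 M.r := by
    have := M.hAr t
    rw [ht] at this
    rw [hR, if_pos rfl, if_neg (by omega), sub_zero]; exact_mod_cast this
  have h2 := cf_choose hNN 0 M.r h1 (M.cExp n t) m
  rw [add_sub_cancel, mul_zero] at h2
  refine h2.trans ?_
  unfold PC
  exact cf_prod_ge (fun t => Polynomial.C (M.Apoly t)) M.NNA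
    (fun t => by rw [cf_CA, M.hA0]; simp) (M.cExp n) t _ _

/-- explicit lower bound along multiples -/
lemma lower_exists : ∃ c : ℝ, ∃ ε : ℝ, 0 < ε ∧ ∃ d : ℕ, 0 < d ∧ ∀ α : ℝ, 0 < α → α ≤ ε →
    ∀ n₀, M.Adm α n₀ → M.Adm α (d * n₀) ∧
      M.T / M.ψ * α * Real.log α + c * α ≤
        Real.log (M.ENw (d * n₀) ⌊α * ((d * n₀ : ℕ) : ℝ)⌋₊) / ((d * n₀ : ℕ) : ℝ) := by
  obtain ⟨t, i, j, hB, h0, hT⟩ := M.T_attain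
  obtain ⟨s, hs⟩ := M.r_attain
  obtain ⟨hi1, -, hj, -⟩ := M.B_mem (t := t) (u := i) (v := j) hB.ne' (by simpa using h0)
  have hpd := M.h_pd2 t
  have hir : (0:ℝ) < i := by exact_mod_cast hi1
  have hjr : (0:ℝ) < j := by exact_mod_cast (by omega : 0 < j)
  have hr := M.r_pos
  have hrn : 0 < M.r := by have := M.r_ge; omega
  have hlam := M.intlam_pos
  have hl := M.hlampos t
  have hρ := M.hρpos s
  have hq : (0:ℝ) < M.q t := by exact_mod_cast M.h_q1 t
  have hsl : (0:ℝ) < M.s s := by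
    have := M.h_hs s
    exact_mod_cast (by omega : 0 < M.s s)
  set c₁ : ℝ := M.lam t * i / (M.q t * M.intlam) with hc₁
  set c₂ : ℝ := M.ρ s * i * M.r / (M.s s * j * M.intlam) with hc₂
  set c₃ : ℝ := i / (j * M.intlam) with hc₃
  have hc₁p : 0 < c₁ := by positivity
  have hc₂p : 0 < c₂ := by positivity
  have hc₃p : 0 < c₃ := by positivity
  refine ⟨1 / i * Real.log c₁ + j / (i * M.r) * Real.log c₂ - j / i * (1 + Real.log c₃),
    min c₁ (min c₂ c₃), by positivity, i * M.r, by positivity, ?_⟩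
  intro α hα hαε n₀ hA
  have hα1 : α ≤ c₁ := hαε.trans (min_le_left _ _)
  have hα2 : α ≤ c₂ := hαε.trans ((min_le_right _ _).trans (min_le_left _ _))
  have hα3 : α ≤ c₃ := hαε.trans ((min_le_right _ _).trans (min_le_right _ _))
  rw [adm_iff] at hA
  obtain ⟨hI0, hw0, -⟩ := hA
  set w₀ := ⌊α * (n₀ : ℝ)⌋₊ with hw₀
  have hn0 : (0:ℝ) < n₀ := by exact_mod_cast hI0.1
  obtain ⟨hI, -, -, -, hwn, hw'⟩ := M.comb_aux hI0 hI0 hw0 hw0 (i * M.r - 1)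
  have hd : (i * M.r - 1) * n₀ + n₀ = i * M.r * n₀ := by
    have : 0 < i * M.r := by positivity
    obtain ⟨e, he⟩ : ∃ e, i * M.r = e + 1 := ⟨i * M.r - 1, by omega⟩
    rw [he, Nat.add_sub_cancel]; ring
  rw [hd] at hI hwn hw'
  set n := i * M.r * n₀ with hn
  have hnr : (n:ℝ) = i * M.r * n₀ := by rw [hn]; push_cast; ring
  have hnp : (0:ℝ) < n := by exact_mod_cast hI.1
  have hw0p : 0 < w₀ := by
    have : (0:ℝ) < w₀ := by rw [hw0]; positivity
    exact_mod_cast this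
  have hwr : (⌊α * (n:ℝ)⌋₊) = i * M.r * w₀ := by
    have : ((⌊α * (n:ℝ)⌋₊ : ℕ) : ℝ) = ((i * M.r * w₀ : ℕ) : ℝ) := by
      rw [hw']; push_cast; rw [hw0, hnr]; ring
    exact_mod_cast this
  set m := M.r * w₀ with hm
  set m' := j * w₀ with hm'
  have hmv : m * j = m' * M.r := by rw [hm, hm']; ring
  have hmi : m * i = i * M.r * w₀ := by rw [hm]; ring
  have hmp : 0 < m := by positivity
  have hm'p : 0 < m' := Nat.mul_pos (by omega) hw0p
  have hmr : (m:ℝ) = α * n / i := by rw [hm]; push_cast; rw [hw0, hnr]; field_simp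
  have hm'r : (m':ℝ) = α * n * j / (i * M.r) := by rw [hm']; push_cast; rw [hw0, hnr]; field_simp
  have hvr : ((m * j : ℕ):ℝ) = α * n * j / i := by push_cast; rw [hmr]; ring
  have hmp' : (0:ℝ) < m := by exact_mod_cast hmp
  have hm'p' : (0:ℝ) < m' := by exact_mod_cast hm'p
  have hvp : 0 < m * j := by rw [hmv]; positivity
  have hvp' : (0:ℝ) < ((m * j : ℕ):ℝ) := by exact_mod_cast hvp
  have r1 : (M.vExp n t : ℝ) / m = c₁ / α := by
    rw [hI.2.2.2, hI.2.1, hmr, hc₁]; field_simp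
  have r2 : (M.cExp n s : ℝ) / m' = c₂ / α := by
    rw [hI.2.2.1, hI.2.1, hm'r, hc₂]; field_simp
  have r3 : (M.En n : ℝ) / ((m * j : ℕ):ℝ) = c₃ / α := by
    rw [hI.2.1, hvr, hc₃]; field_simp
  have l1 : m ≤ M.vExp n t := by
    have : 1 ≤ (M.vExp n t : ℝ) / m := by rw [r1, le_div_iff₀ hα]; linarith
    rw [le_div_iff₀ hmp', one_mul] at this
    exact_mod_cast this
  have l2 : m' ≤ M.cExp n s := by
    have : 1 ≤ (M.cExp n s : ℝ) / m' := by rw [r2, le_div_iff₀ hα]; linarith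
    rw [le_div_iff₀ hm'p', one_mul] at this
    exact_mod_cast this
  have l3 : m * j ≤ M.En n := by
    have : 1 ≤ (M.En n : ℝ) / ((m * j : ℕ):ℝ) := by rw [r3, le_div_iff₀ hα]; linarith
    rw [le_div_iff₀ hvp', one_mul] at this
    exact_mod_cast this
  have b1 := (choose_ge _ _ hmp l1).trans (M.Nv_lower t i j hB h0 n m)
  have b2 := (choose_ge _ _ hm'p l2).trans (M.Nc_lower s hs n m')
  have b3 := choose_le (M.En n) (m * j) hvp
  rw [r1] at b1
  rw [r2] at b2
  rw [mul_div_assoc, r3] at b3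
  rw [← hmv] at b2
  have hch : (0:ℝ) < ((M.En n).choose (m * j) : ℝ) := by exact_mod_cast Nat.choose_pos l3
  have hlow : (c₁ / α) ^ m * (c₂ / α) ^ m' / (Real.exp 1 * (c₃ / α)) ^ (m * j) ≤
      M.ENw n ⌊α * (n:ℝ)⌋₊ := by
    refine le_trans ?_ (M.term_le n _ (m * j) l3)
    unfold term
    rw [hwr, ← hmi]
    apply div_le_div₀ (mul_nonneg (M.Nv_nn _ _ _) (M.Nc_nn _ _)) _ hch b3
    exact mul_le_mul b1 b2 (by positivity) (M.Nv_nn _ _ _)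
  have hpos : 0 < (c₁ / α) ^ m * (c₂ / α) ^ m' / (Real.exp 1 * (c₃ / α)) ^ (m * j) := by positivity
  refine ⟨(M.adm_iff α n).mpr ⟨hI, hw', lt_of_lt_of_le hpos hlow⟩, ?_⟩
  rw [le_div_iff₀ hnp]
  refine le_trans ?_ (Real.log_le_log hpos hlow)
  clear_value c₁ c₂ c₃ m m'
  rw [Real.log_div (by positivity) (by positivity), Real.log_mul (by positivity) (by positivity),
    Real.log_pow, Real.log_pow, Real.log_pow, Real.log_mul (by positivity) (by positivity),
    Real.log_exp, Real.log_div hc₁p.ne' hα.ne', Real.log_div hc₂p.ne' hα.ne',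
    Real.log_div hc₃p.ne' hα.ne', hmr, hm'r, hvr]
  have hTψ : M.T / M.ψ = j / i - j / (i * M.r) - 1 / i := by
    have hψi := M.ψ_inv
    have hψ := M.ψ_pos
    have : M.T / M.ψ = (j * (1 / M.ψ) - 1) / i := by
      rw [hT]; unfold Tij; field_simp
    rw [this, hψi]; field_simp
  rw [hTψ]
  apply le_of_eq
  field_simp
  ring

lemma grSeq_eq (α : ℝ) (n : ℕ) : M.grSeq α n = Real.log (M.ENw n ⌊α * (n : ℝ)⌋₊) / n := by
  unfold grSeq; ring

lemma err_nn (n : ℕ) : 0 ≤ M.err n := by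
  unfold err
  have : 0 ≤ Real.log ((n:ℝ) / M.intlam + 1) := Real.log_nonneg (by
    have := M.intlam_pos
    have : 0 ≤ (n:ℝ) / M.intlam := by positivity
    linarith)
  linarith

lemma err_t : Filter.Tendsto (fun n : ℕ => M.err n / n) Filter.atTop (nhds 0) :=
  err_tendsto M.intlam M.intlam_pos

lemma err_bdd : ∃ b : ℝ, ∀ n : ℕ, M.err n / n ≤ b := by
  obtain ⟨b, hb⟩ := M.err_t.bddAbove_range
  exact ⟨b, fun n => hb ⟨n, rfl⟩⟩

lemma main_two : ∃ k : ℝ, 0 < k ∧ ∃ ε : ℝ, 0 < ε ∧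
      ∀ α : ℝ, 0 < α → α ≤ ε → {n : ℕ | M.Adm α n}.Infinite →
        ∃ G : ℝ,
          Filter.Tendsto (M.grSeq α)
            (Filter.atTop ⊓ Filter.principal {n : ℕ | M.Adm α n}) (nhds G) ∧
          |G - (M.T / M.ψ) * α * Real.log α| ≤ k * α := by
  obtain ⟨c, ε, hε, d, hd, hlow⟩ := M.lower_exists
  have hlam := M.intlam_pos
  have hQ : (0:ℝ) < M.Qm := by exact_mod_cast M.Qm_pos
  set c' := M.K1 + M.T / M.ψ * Real.log (M.Qm * M.intlam) with hc'
  refine ⟨|c| + |c'| + 1, by positivity, min ε (1 / (2 * (M.Qm * M.intlam))), by positivity, ?_⟩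
  intro α hα hαε hinf
  have hα1 : α ≤ ε := hαε.trans (min_le_left _ _)
  have hβ : M.Qm * M.intlam * α < 1 := by
    have := hαε.trans (min_le_right _ _)
    rw [le_div_iff₀ (by positivity)] at this
    linarith
  have hupp : ∀ n ∈ {n : ℕ | M.Adm α n}, M.grSeq α n ≤ M.err n / n +
      (α * c' + M.T / M.ψ * α * Real.log α) := by
    intro n hn
    rw [grSeq_eq]
    exact M.gr_upper hα hβ.le hn
  obtain ⟨b, hb⟩ := M.err_bdd
  obtain ⟨G, hG⟩ := fekete {n : ℕ | M.Adm α n} hinf (fun n hn => hn.1)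
    (fun n => Real.log (M.ENw n ⌊α * (n : ℝ)⌋₊)) M.err M.err_nn M.err_t
    (b + (α * c' + M.T / M.ψ * α * Real.log α))
    (fun n hn => by
      have h1 := hupp n hn
      rw [grSeq_eq] at h1
      have h2 := hb n
      linarith)
    (fun n₁ h1 n₂ h2 => M.fek_ineq hα hβ h1 h2)
  have hG' : Filter.Tendsto (M.grSeq α)
      (Filter.atTop ⊓ Filter.principal {n : ℕ | M.Adm α n}) (nhds G) :=
    hG.congr (fun n => (M.grSeq_eq α n).symm)
  have hne : (Filter.atTop ⊓ Filter.principal {n : ℕ | M.Adm α n}).NeBot := by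
    rw [← Filter.frequently_mem_iff_neBot]
    exact Nat.frequently_atTop_iff_infinite.mpr hinf
  refine ⟨G, hG', ?_⟩
  have hevS : ∀ᶠ n in Filter.atTop ⊓ Filter.principal {n : ℕ | M.Adm α n}, n ∈ {n : ℕ | M.Adm α n} :=
    Filter.eventually_inf_principal.mpr (Filter.Eventually.of_forall fun n hn => hn)
  have hGu : G ≤ α * c' + M.T / M.ψ * α * Real.log α := by
    have hlim : Filter.Tendsto (fun n : ℕ => M.err n / n + (α * c' + M.T / M.ψ * α * Real.log α))
      (Filter.atTop ⊓ Filter.principal {n : ℕ | M.Adm α n})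
      (nhds (0 + (α * c' + M.T / M.ψ * α * Real.log α))) :=
      (M.err_t.mono_left inf_le_left).add tendsto_const_nhds
    rw [zero_add] at hlim
    exact le_of_tendsto_of_tendsto hG' hlim (hevS.mono fun n hn => hupp n hn)
  have hGl : M.T / M.ψ * α * Real.log α + c * α ≤ G := by
    by_contra hc
    rw [not_le] at hc
    have hev := hG'.eventually (gt_mem_nhds hc)
    rw [Filter.eventually_inf_principal, Filter.eventually_atTop] at hev
    obtain ⟨N, hN⟩ := hev
    obtain ⟨n₀, hn₀, hNn⟩ := hinf.exists_gt N
    obtain ⟨hA, hb⟩ := hlow α hα hα1 n₀ hn₀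
    have := hN (d * n₀) (by nlinarith) hA
    rw [grSeq_eq] at this
    linarith
  rw [abs_le]
  have a1 := mul_le_mul_of_nonneg_left (le_abs_self c') hα.le
  have a2 := mul_le_mul_of_nonneg_left (neg_abs_le c) hα.le
  have a3 := mul_nonneg hα.le (abs_nonneg c)
  have a4 := mul_nonneg hα.le (abs_nonneg c')
  constructor <;> nlinarith

end DGLDPC


/-- **Corollary 1.** If `r > 2` or `p > 2`, then `T > 0`, the growth rate satisfies
`G(α) = (T/ψ) α log α + O(α)`, and consequently `α* > 0`: the ensemble sequence has
good growth rate behavior (for all small enough `α > 0`, the growth rate is negative). -/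
theorem cor1_good_growth_rate (M : DGLDPC) (h : 2 < M.r ∨ 2 < M.p) :
    0 < M.T ∧
    (∃ k : ℝ, 0 < k ∧ ∃ ε : ℝ, 0 < ε ∧
      ∀ α : ℝ, 0 < α → α ≤ ε → {n : ℕ | M.Adm α n}.Infinite →
        ∃ G : ℝ,
          Filter.Tendsto (M.grSeq α)
            (Filter.atTop ⊓ Filter.principal {n : ℕ | M.Adm α n}) (nhds G) ∧
          |G - (M.T / M.ψ) * α * Real.log α| ≤ k * α) ∧
    (∃ α0 : ℝ, 0 < α0 ∧
      ∀ α : ℝ, 0 < α → α < α0 → {n : ℕ | M.Adm α n}.Infinite →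
        ∀ G : ℝ,
          Filter.Tendsto (M.grSeq α)
            (Filter.atTop ⊓ Filter.principal {n : ℕ | M.Adm α n}) (nhds G) →
          G < 0) := by
  have hT := M.T_pos h
  obtain ⟨k, hk, ε, hε, hmain⟩ := M.main_two
  refine ⟨hT, ⟨k, hk, ε, hε, hmain⟩, ?_⟩
  have hψ := M.ψ_pos
  have hTψ : 0 < M.T / M.ψ := div_pos hT hψ
  refine ⟨min ε (Real.exp (-(k / (M.T / M.ψ)))), lt_min hε (Real.exp_pos _), ?_⟩
  intro α hα hα0 hinf G hG
  obtain ⟨G', hG', hb⟩ := hmain α hα (hα0.le.trans (min_le_left _ _)) hinf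
  have hne : (Filter.atTop ⊓ Filter.principal {n : ℕ | M.Adm α n}).NeBot := by
    rw [← Filter.frequently_mem_iff_neBot]
    exact Nat.frequently_atTop_iff_infinite.mpr hinf
  have hGG : G = G' := tendsto_nhds_unique hG hG'
  subst hGG
  have hlog : Real.log α < -(k / (M.T / M.ψ)) := by
    rw [Real.log_lt_iff_lt_exp hα]
    exact lt_of_lt_of_le hα0 (min_le_right _ _)
  have h1 := (abs_le.mp hb).2
  have h2 : (M.T / M.ψ) * Real.log α < -k := by
    have := mul_lt_mul_of_pos_left hlog hTψ
    have e : M.T / M.ψ * -(k / (M.T / M.ψ)) = -k := by field_simp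
    linarith
  nlinarith
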